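/- Let q₁, q₂ ≥ 2, m₁, m₂ ≥ 1 and l₁, l₂ be integers such that gcd(q₁,q₂) = 1, gcd(m₁, q₁ − 1) = 1 and gcd(m₂, q₂ − 1) = 1, and let 1 < c < 18/17. Then there exists ε > 0 such that, as x → ∞, #{n ≤ x : s_{q₁}(⌊n^c⌋) ≡ l₁ (mod m₁) and s_{q₂}(⌊n^c⌋) ≡ l₂ (mod m₂)} = x/(m₁·m₂) + O(x^{1−ε}). -/

import Mathlib

open scoped BigOperators

/-- `s q n` is the sum of digits of `n` in base `q`. -/
def s (q n : ℕ) : ℕ := (Nat.digits q n).sum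

open Finset ZMod
open scoped ComplexConjugate

/-- The exponential `e(θ) = exp(2πiθ)`. -/
noncomputable def ex (θ : ℝ) : ℂ := Complex.exp (2 * Real.pi * Complex.I * θ)

lemma ex_add (a b : ℝ) : ex (a + b) = ex a * ex b := by
  simp only [ex, ← Complex.exp_add]; push_cast; ring_nf

lemma ex_zero : ex 0 = 1 := by simp [ex]

lemma norm_ex (a : ℝ) : ‖ex a‖ = 1 := by
  have : ex a = Complex.exp ((2 * Real.pi * a : ℝ) * Complex.I) := by
    simp only [ex]; push_cast; ring_nf
  rw [this, Complex.norm_exp_ofReal_mul_I]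

lemma ex_nat_mul (n : ℕ) (a : ℝ) : ex (n * a) = ex a ^ n := by
  simp only [ex, ← Complex.exp_nat_mul]; push_cast; ring_nf

lemma ex_int (n : ℤ) : ex n = 1 := by
  rw [ex, Complex.exp_eq_one_iff]; exact ⟨n, by push_cast; ring⟩

lemma ex_eq_one_iff (a : ℝ) : ex a = 1 ↔ ∃ n : ℤ, a = n := by
  constructor
  · intro h
    rw [ex, Complex.exp_eq_one_iff] at h
    obtain ⟨n, hn⟩ := h
    refine ⟨n, ?_⟩
    have h2 : (2 * Real.pi * Complex.I : ℂ) ≠ 0 := by simp [Real.pi_ne_zero]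
    have : (a : ℂ) = n := by
      apply mul_left_cancel₀ h2; rw [hn]; ring
    exact_mod_cast this
  · rintro ⟨n, rfl⟩; exact ex_int n

lemma continuous_ex : Continuous ex := by unfold ex; fun_prop

section DFT

variable {N : ℕ} [NeZero N]

lemma conj_stdAddChar (j : ZMod N) :
    conj (stdAddChar j : ℂ) = stdAddChar (-j) := by
  rw [AddChar.map_neg_eq_conj]

lemma sum_normSq_dft (Φ : ZMod N → ℂ) :
    ∑ k, ‖dft Φ k‖ ^ 2 = N * ∑ j, ‖Φ j‖ ^ 2 := by
  have key : ∑ k, dft Φ k * conj (dft Φ k) = N * ∑ j, Φ j * conj (Φ j) := by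
    have h1 : ∀ k, dft Φ k * conj (dft Φ k)
        = ∑ j, conj (Φ j) * (stdAddChar (-(k * (-j))) * dft Φ k) := by
      intro k
      conv_lhs => rw [dft_apply Φ k]
      conv_lhs => arg 2; rw [map_sum]
      rw [Finset.mul_sum]
      refine Finset.sum_congr rfl fun j _ => ?_
      rw [smul_eq_mul, map_mul, conj_stdAddChar, ← dft_apply Φ k]
      have : -(-(j * k)) = -(k * (-j)) := by ring
      rw [this]; ring
    simp_rw [h1]
    rw [Finset.sum_comm, Finset.mul_sum]
    refine Finset.sum_congr rfl fun j _ => ?_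
    rw [← Finset.mul_sum]
    have h2 : ∑ k, stdAddChar (-(k * (-j))) * dft Φ k = dft (dft Φ) (-j) := by
      rw [dft_apply (dft Φ)]; rfl
    rw [h2, dft_dft]
    simp; ring
  have h3 : ∀ z : ℂ, z * conj z = ((‖z‖ ^ 2 : ℝ) : ℂ) := by
    intro z; rw [Complex.mul_conj, Complex.normSq_eq_norm_sq]
  simp_rw [h3] at key
  exact_mod_cast key

/-- The autocorrelation of a function on `ℤ/N`. -/
noncomputable def corr (Φ : ZMod N → ℂ) (d : ZMod N) : ℂ := ∑ t, Φ (t + d) * conj (Φ t)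

lemma dft_corr (Φ : ZMod N → ℂ) (k : ZMod N) :
    dft (corr Φ) k = ((‖dft Φ k‖ ^ 2 : ℝ) : ℂ) := by
  rw [← Complex.normSq_eq_norm_sq, ← Complex.mul_conj, dft_apply]
  simp only [corr, smul_eq_mul, Finset.mul_sum]
  rw [Finset.sum_comm]
  conv_rhs => arg 2; rw [dft_apply, map_sum]
  rw [Finset.mul_sum]
  refine Finset.sum_congr rfl fun t _ => ?_
  rw [smul_eq_mul, map_mul, conj_stdAddChar, dft_apply, Finset.sum_mul,
    ← Equiv.sum_comp (Equiv.addLeft t) (fun j => stdAddChar (-(j * k)) • Φ j * _)]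
  refine Finset.sum_congr rfl fun d _ => ?_
  simp only [Equiv.coe_addLeft, smul_eq_mul]
  have : (-(d * k) : ZMod N) = -((t + d) * k) + - -(t * k) := by ring
  rw [this, AddChar.map_add_eq_mul]; ring

/-- An `L^∞` bound for the Fourier transform yields an `L^1` bound for the autocorrelation. -/
lemma sum_norm_corr_le (Φ : ZMod N → ℂ) (hΦ : ∀ z, ‖Φ z‖ ≤ 1) (M : ℝ) (hM : 0 ≤ M)
    (h : ∀ k, ‖dft Φ k‖ ≤ M) : ∑ d, ‖corr Φ d‖ ≤ M * N := by
  have hN : (0 : ℝ) < N := by exact_mod_cast Nat.pos_of_ne_zero (NeZero.ne N)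
  have h1 : (∑ d, ‖corr Φ d‖) ^ 2 ≤ N * ∑ d, ‖corr Φ d‖ ^ 2 := by
    have := sq_sum_le_card_mul_sum_sq (s := (univ : Finset (ZMod N))) (f := fun d => ‖corr Φ d‖)
    simpa [ZMod.card] using this
  rw [← sum_normSq_dft] at h1
  have h2 : ∑ k, ‖dft (corr Φ) k‖ ^ 2 ≤ M ^ 2 * ∑ k, ‖dft Φ k‖ ^ 2 := by
    rw [Finset.mul_sum]
    refine Finset.sum_le_sum fun k _ => ?_
    rw [dft_corr, Complex.norm_real, Real.norm_eq_abs, abs_of_nonneg (by positivity), sq (‖_‖ ^ 2)]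
    gcongr
    exact h k
  rw [sum_normSq_dft Φ] at h2
  have h3 : ∑ j, ‖Φ j‖ ^ 2 ≤ N := by
    calc ∑ j, ‖Φ j‖ ^ 2 ≤ ∑ j : ZMod N, (1 : ℝ) := by
          refine Finset.sum_le_sum fun k _ => ?_
          exact pow_le_one₀ (norm_nonneg _) (hΦ k)
      _ = N := by simp [ZMod.card]
  refine le_of_sq_le_sq ?_ (by positivity)
  calc _ ≤ _ := h1
    _ ≤ M ^ 2 * (N * ∑ j, ‖Φ j‖ ^ 2) := h2
    _ ≤ M ^ 2 * (N * N) := by gcongr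
    _ = _ := by ring

end DFT

lemma norm_one_add_lt {z : ℂ} (hz : ‖z‖ = 1) (h : z ≠ 1) : ‖1 + z‖ < 2 := by
  by_contra hc
  push Not at hc
  apply h
  have h1 : ‖1 + z‖ ^ 2 = 2 + 2 * z.re := by
    have h2 : ‖z‖ ^ 2 = 1 := by rw [hz]; norm_num
    rw [← Complex.normSq_eq_norm_sq, Complex.normSq_apply] at *
    simp at *; nlinarith
  have h2 : z.re ^ 2 + z.im ^ 2 = 1 := by
    have : ‖z‖ ^ 2 = 1 := by rw [hz]; norm_num
    rw [← Complex.normSq_eq_norm_sq, Complex.normSq_apply] at this; nlinarith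
  have h3 : 1 ≤ z.re := by nlinarith
  have h4 : z.re = 1 := by nlinarith [sq_nonneg z.im]
  have h5 : z.im = 0 := by
    have : z.im ^ 2 = 0 := by rw [h4] at h2; linarith
    exact pow_eq_zero_iff (two_ne_zero) |>.1 this
  exact Complex.ext (by simpa using h4) (by simpa using h5)

lemma norm_sum_ex_le (q : ℕ) (β : ℝ) : ‖∑ u ∈ range q, ex (β * u)‖ ≤ q := by
  refine (norm_sum_le _ _).trans ?_
  simp [norm_ex]

lemma norm_sum_ex_lt {q : ℕ} (hq : 2 ≤ q) {β : ℝ} (hβ : ex β ≠ 1) :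
    ‖∑ u ∈ range q, ex (β * u)‖ < q := by
  obtain ⟨r, rfl⟩ := Nat.exists_eq_add_of_le hq
  rw [Finset.sum_range_add]
  calc _ ≤ ‖∑ u ∈ range 2, ex (β * u)‖ + ‖∑ x ∈ range r, ex (β * ↑(2 + x))‖ := norm_add_le _ _
    _ < 2 + r := by
      refine add_lt_add_of_lt_of_le ?_ ?_
      · simpa [Finset.sum_range_succ, ex_zero] using norm_one_add_lt (norm_ex β) hβ
      · refine (norm_sum_le _ _).trans ?_
        simp [norm_ex]
    _ = _ := by push_cast; ring

lemma exists_two_step_bound {q : ℕ} (hq : 2 ≤ q) {α : ℝ} (hα : ¬ ∃ n : ℤ, ((q : ℝ) - 1) * α = n) :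
    ∃ ρ : ℝ, 1 ≤ ρ ∧ ρ < (q : ℝ) ^ 2 ∧ ∀ θ : ℝ,
      ‖∑ u ∈ range q, ex ((α + θ) * u)‖ * ‖∑ u ∈ range q, ex ((α + q * θ) * u)‖ ≤ ρ := by
  set P : ℝ → ℝ := fun θ =>
    ‖∑ u ∈ range q, ex ((α + θ) * u)‖ * ‖∑ u ∈ range q, ex ((α + q * θ) * u)‖ with hP
  have hcont : Continuous P := by
    have := continuous_ex
    fun_prop
  obtain ⟨θ₀, -, hmax⟩ := isCompact_Icc.exists_isMaxOn (Set.nonempty_Icc.2 (zero_le_one' ℝ))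
    hcont.continuousOn
  have hq0 : (0 : ℝ) < q := by positivity
  have hlt : P θ₀ < (q : ℝ) ^ 2 := by
    by_cases h1 : ex (α + θ₀) = 1
    · by_cases h2 : ex (α + q * θ₀) = 1
      · exfalso
        obtain ⟨a, ha⟩ := (ex_eq_one_iff _).1 h1
        obtain ⟨b, hb⟩ := (ex_eq_one_iff _).1 h2
        refine hα ⟨q * a - b, ?_⟩
        push_cast
        rw [← ha, ← hb]; ring
      · have := norm_sum_ex_lt hq h2
        have h3 := norm_sum_ex_le q (α + θ₀)
        simp only [hP, sq]
        nlinarith [norm_nonneg (∑ u ∈ range q, ex ((α + q * θ₀) * u))]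
    · have := norm_sum_ex_lt hq h1
      have h3 := norm_sum_ex_le q (α + q * θ₀)
      simp only [hP, sq]
      nlinarith [norm_nonneg (∑ u ∈ range q, ex ((α + θ₀) * u))]
  refine ⟨max (P θ₀) 1, le_max_right _ _, max_lt hlt ?_, fun θ => ?_⟩
  · have : (2 : ℝ) ≤ q := by exact_mod_cast hq
    nlinarith
  · have hper : P θ = P (Int.fract θ) := by
      have e1 : ∀ u : ℕ, ex ((α + θ) * u) = ex ((α + Int.fract θ) * u) := by
        intro u
        have : (α + θ) * u = (α + Int.fract θ) * u + ((⌊θ⌋ * u : ℤ) : ℝ) := by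
          rw [Int.fract]; push_cast; ring
        rw [this, ex_add, ex_int, mul_one]
      have e2 : ∀ u : ℕ, ex ((α + q * θ) * u) = ex ((α + q * Int.fract θ) * u) := by
        intro u
        have : (α + q * θ) * u = (α + q * Int.fract θ) * u + ((⌊θ⌋ * q * u : ℤ) : ℝ) := by
          rw [Int.fract]; push_cast; ring
        rw [this, ex_add, ex_int, mul_one]
      simp only [hP, e1, e2]
    have : P (Int.fract θ) ≤ P θ₀ := hmax ⟨Int.fract_nonneg _, (Int.fract_lt_one _).le⟩
    exact (hper.le.trans this).trans (le_max_left _ _)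

lemma s_zero (q : ℕ) : s q 0 = 0 := by simp [s]

lemma s_add_mul {q : ℕ} (hq : 2 ≤ q) {u : ℕ} (hu : u < q) (t : ℕ) : s q (u + q * t) = u + s q t := by
  rcases Nat.eq_zero_or_pos (u + q * t) with h | h
  · have hu0 : u = 0 := by omega
    have ht : t = 0 := by
      rcases Nat.eq_zero_or_pos t with h' | h'
      · exact h'
      · have : 0 < q * t := by positivity
        omega
    simp [hu0, ht, s_zero]
  · rw [s, Nat.digits_def' (by omega) h, List.sum_cons]
    rw [Nat.add_mul_mod_self_left, Nat.mod_eq_of_lt hu, Nat.add_mul_div_left _ _ (by omega),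
      Nat.div_eq_of_lt hu, zero_add, s]

lemma s_eq {q : ℕ} (hq : 2 ≤ q) (n : ℕ) : s q n = n % q + s q (n / q) := by
  conv_lhs => rw [← Nat.mod_add_div n q]
  exact s_add_mul hq (Nat.mod_lt _ (by omega)) _

lemma s_split {q : ℕ} (hq : 2 ≤ q) (l n : ℕ) : s q n = s q (n / q ^ l) + s q (n % q ^ l) := by
  induction l generalizing n with
  | zero => simp [Nat.mod_one, s_zero]
  | succ l ih =>
    rw [s_eq hq n, ih (n / q), s_eq hq (n % q ^ (l + 1))]
    have h1 : n / q / q ^ l = n / q ^ (l + 1) := by rw [Nat.div_div_eq_div_mul, pow_succ']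
    have h2 : n % q ^ (l + 1) % q = n % q := Nat.mod_mod_of_dvd _ (dvd_pow_self _ (by omega))
    have h3 : n % q ^ (l + 1) / q = n / q % q ^ l := by
      rw [pow_succ', Nat.mod_mul_right_div_self]
    rw [h1, h2, h3]; ring

lemma sum_range_mul_eq (q m : ℕ) (F : ℕ → ℂ) :
    ∑ t ∈ range (q * m), F t = ∑ t ∈ range m, ∑ u ∈ range q, F (u + q * t) := by
  induction m with
  | zero => simp
  | succ m ih =>
    rw [mul_add, mul_one, Finset.sum_range_add, ih, Finset.sum_range_succ]
    simp_rw [add_comm]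

/-- Exponential sums twisted by the sum-of-digits function save a power, uniformly in the frequency. -/
lemma exists_digit_sum_bound {q : ℕ} (hq : 2 ≤ q) {α : ℝ}
    (hα : ¬ ∃ n : ℤ, ((q : ℝ) - 1) * α = n) :
    ∃ τ : ℝ, 0 ≤ τ ∧ τ < 1 ∧ ∀ (l : ℕ) (θ : ℝ),
      ‖∑ t ∈ range (q ^ l), ex (α * s q t + θ * t)‖ ≤ q * ((q : ℝ) ^ l) ^ τ := by
  obtain ⟨ρ, hρ1, hρq, hρ⟩ := exists_two_step_bound hq hα
  have hq1 : (1 : ℝ) < q := by exact_mod_cast hq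
  have hq0 : (0 : ℝ) < q := by linarith
  set σ := Real.sqrt ρ
  have hσ1 : 1 ≤ σ := Real.one_le_sqrt.2 hρ1
  have hσ2 : σ ^ 2 = ρ := Real.sq_sqrt (by linarith)
  have hσq : σ < q := by
    by_contra h
    push Not at h
    nlinarith
  have hrec : ∀ (l : ℕ) (θ : ℝ), ∑ t ∈ range (q ^ (l + 1)), ex (α * s q t + θ * t)
      = (∑ u ∈ range q, ex ((α + θ) * u)) * ∑ t ∈ range (q ^ l), ex (α * s q t + q * θ * t) := by
    intro l θ
    rw [pow_succ', sum_range_mul_eq, Finset.sum_mul, Finset.sum_comm]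
    refine Finset.sum_congr rfl fun u hu => ?_
    rw [Finset.mul_sum]
    refine Finset.sum_congr rfl fun t _ => ?_
    rw [s_add_mul hq (mem_range.1 hu), ← ex_add]
    congr 1; push_cast; ring
  have bound : ∀ (l : ℕ), ∀ (θ : ℝ),
      ‖∑ t ∈ range (q ^ l), ex (α * s q t + θ * t)‖ ≤ q * σ ^ l := by
    intro l
    induction l using Nat.twoStepInduction with
    | zero => intro θ; simp [norm_ex]; omega
    | one =>
      intro θ
      refine (norm_sum_le _ _).trans ?_
      simp [norm_ex]
      nlinarith
    | more l ih _ =>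
      intro θ
      rw [hrec, hrec, norm_mul, norm_mul, ← mul_assoc]
      calc _ ≤ ρ * (q * σ ^ l) := by
            refine mul_le_mul (hρ θ) (ih _) (norm_nonneg _) (by linarith)
        _ = _ := by rw [← hσ2]; ring
  refine ⟨Real.log σ / Real.log q, ?_, ?_, fun l θ => ?_⟩
  · exact div_nonneg (Real.log_nonneg hσ1) (Real.log_nonneg hq1.le)
  · rw [div_lt_one (Real.log_pos hq1)]
    exact Real.log_lt_log (by linarith) hσq
  · refine (bound l θ).trans (le_of_eq ?_)
    congr 1
    rw [← Real.rpow_natCast (q : ℝ) l, ← Real.rpow_mul hq0.le, mul_comm, Real.rpow_mul hq0.le,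
      Real.rpow_natCast]
    congr 1
    rw [Real.rpow_def_of_pos hq0, mul_div_cancel₀ _ (Real.log_pos hq1).ne', Real.exp_log (by linarith)]

/-- The digital function `e(α s_q)` truncated to residues modulo `Q`. -/
noncomputable def digitFn (q : ℕ) (α : ℝ) (Q : ℕ) (z : ZMod Q) : ℂ := ex (α * s q z.val)

lemma norm_digitFn (q : ℕ) (α : ℝ) (Q : ℕ) (z : ZMod Q) : ‖digitFn q α Q z‖ = 1 := norm_ex _

lemma ex_s_eq {q : ℕ} (hq : 2 ≤ q) (α : ℝ) (l n : ℕ) :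
    ex (α * s q n) = ex (α * s q (n / q ^ l)) * digitFn q α (q ^ l) n := by
  rw [digitFn, ZMod.val_natCast, ← ex_add, ← mul_add, s_split hq l n]; push_cast; rfl

lemma sum_zmod_eq_sum_range {N : ℕ} [NeZero N] (F : ZMod N → ℂ) :
    ∑ z, F z = ∑ t ∈ range N, F t := by
  refine Finset.sum_bij' (fun z _ => z.val) (fun t _ => (t : ZMod N)) ?_ ?_ ?_ ?_ ?_
  · intro z _; exact mem_range.2 (ZMod.val_lt z)
  · simp
  · intro z _; simp
  · intro t ht; exact ZMod.val_cast_of_lt (mem_range.1 ht)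
  · intro z _; simp

lemma exists_sum_norm_corr_digitFn {q : ℕ} (hq : 2 ≤ q) {α : ℝ}
    (hα : ¬ ∃ n : ℤ, ((q : ℝ) - 1) * α = n) :
    ∃ τ : ℝ, 0 ≤ τ ∧ τ < 1 ∧ ∀ (l : ℕ) [NeZero (q ^ l)],
      ∑ d, ‖corr (digitFn q α (q ^ l)) d‖ ≤ q * ((q : ℝ) ^ l) ^ τ * (q ^ l : ℕ) := by
  obtain ⟨τ, h0, h1, h⟩ := exists_digit_sum_bound hq hα
  refine ⟨τ, h0, h1, fun l _ => ?_⟩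
  refine sum_norm_corr_le _ (fun z => (norm_digitFn _ _ _ z).le) _ (by positivity) fun k => ?_
  refine le_trans (le_of_eq ?_) (h l (-(k.val : ℝ) / (q ^ l : ℕ)))
  rw [dft_apply, sum_zmod_eq_sum_range]
  congr 1
  refine Finset.sum_congr rfl fun t ht => ?_
  have e1 : (-((t : ZMod (q ^ l)) * k)) = ((-(t * k.val : ℤ) : ℤ) : ZMod (q ^ l)) := by
    push_cast; simp
  rw [e1, stdAddChar_coe, digitFn, ZMod.val_cast_of_lt (mem_range.1 ht), add_comm, ex_add,
    smul_eq_mul]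
  congr 1
  rw [ex]
  congr 1
  push_cast
  ring

/-- If `a` is close to `p / b`, few of the points `β + n a` with `n < b` fall into `[u, v]` mod 1. -/
lemma card_le_of_near_rat {b : ℕ} (hb : 1 ≤ b) {p : ℤ} (hp : IsCoprime p (b : ℤ)) {a β u v : ℝ}
    (ha : |a - p / b| ≤ 1 / (b : ℝ) ^ 2) (huv : u ≤ v) (S : Finset ℕ) (hS : S ⊆ range b)
    (h : ∀ n ∈ S, ∃ z : ℤ, u ≤ β + n * a - z ∧ β + n * a - z ≤ v) :
    (S.card : ℝ) ≤ b * (v - u) + 3 := by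
  have hb0 : (0 : ℝ) < b := by exact_mod_cast hb
  choose! z hz using h
  set J : Finset ℤ := Finset.Icc ⌈b * (u - β) - 1⌉ ⌊b * (v - β) + 1⌋ with hJ
  have hcard : S.card ≤ J.card := by
    refine Finset.card_le_card_of_injOn (fun n => n * p - b * z n) ?_ ?_
    · intro n hn
      have hnb : n < b := mem_range.1 (hS hn)
      have hnb' : (n : ℝ) ≤ b := by exact_mod_cast hnb.le
      obtain ⟨h1, h2⟩ := hz n hn
      have herr : |b * (n * a) - n * p| ≤ 1 := by
        have : b * (n * a) - n * p = b * n * (a - p / b) := by field_simp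
        rw [this, abs_mul, abs_of_nonneg (by positivity)]
        calc _ ≤ (b * b : ℝ) * (1 / (b : ℝ) ^ 2) := by gcongr
          _ = 1 := by field_simp
      obtain ⟨h3, h4⟩ := abs_le.1 herr
      have h5 := mul_le_mul_of_nonneg_left h1 hb0.le
      have h6 := mul_le_mul_of_nonneg_left h2 hb0.le
      simp only [hJ, Finset.coe_Icc, Set.mem_Icc, Int.ceil_le, Int.le_floor]
      push_cast
      constructor <;> nlinarith
    · intro n hn m hm hnm
      have hnb : n < b := mem_range.1 (hS hn)
      have hmb : m < b := mem_range.1 (hS hm)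
      simp only at hnm
      have h1 : (b : ℤ) ∣ ((n : ℤ) - m) * p := ⟨z n - z m, by linarith⟩
      have h2 : (b : ℤ) ∣ (n : ℤ) - m := hp.symm.dvd_of_dvd_mul_right h1
      have h3 : ((n : ℤ) - m) = 0 := by
        refine Int.eq_zero_of_abs_lt_dvd h2 ?_
        rw [abs_lt]; omega
      omega
  have hJc : (J.card : ℝ) ≤ b * (v - u) + 3 := by
    rw [hJ, Int.card_Icc]
    have h1 := Int.floor_le (b * (v - β) + 1)
    have h2 := Int.le_ceil (b * (u - β) - 1)
    have h3 : (0 : ℝ) ≤ b * (v - u) := mul_nonneg hb0.le (by linarith)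
    rcases le_total 0 (⌊b * (v - β) + 1⌋ + 1 - ⌈b * (u - β) - 1⌉) with h | h
    · have : (((⌊b * (v - β) + 1⌋ + 1 - ⌈b * (u - β) - 1⌉).toNat : ℤ) : ℝ)
          = ⌊b * (v - β) + 1⌋ + 1 - ⌈b * (u - β) - 1⌉ := by
        rw [Int.toNat_of_nonneg h]; push_cast; ring
      rw [Int.cast_natCast] at this
      rw [this]; nlinarith
    · rw [Int.toNat_of_nonpos h]; push_cast; linarith
  exact le_trans (by exact_mod_cast hcard) hJc

/-- An upper bound for every cell of a partition gives an asymptotic for sums over the cells. -/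
lemma norm_sum_cell_sub_le {ι : Type*} [Fintype ι] [DecidableEq ι] (b : ℕ) (cell : ℕ → ι)
    (w : ι → ℝ) (hw : ∑ i, w i = 1) (C : ℝ) (hC : 0 ≤ C)
    (h : ∀ i, (((range b).filter fun n => cell n = i).card : ℝ) ≤ b * w i + C)
    (Ψ : ι → ℂ) (hΨ : ∀ i, ‖Ψ i‖ ≤ 1) :
    ‖∑ n ∈ range b, Ψ (cell n) - b * ∑ i, (w i : ℂ) * Ψ i‖ ≤ 2 * C * Fintype.card ι := by
  set cnt : ι → ℝ := fun i => (((range b).filter fun n => cell n = i).card : ℝ) with hcnt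
  have h1 : ∑ n ∈ range b, Ψ (cell n) = ∑ i, (cnt i : ℂ) * Ψ i := by
    rw [← Finset.sum_fiberwise (range b) cell]
    refine Finset.sum_congr rfl fun i _ => ?_
    rw [Finset.sum_congr rfl (g := fun _ => Ψ i)]
    · simp [hcnt]
    · intro n hn; rw [(mem_filter.1 hn).2]
  have h2 : ∑ i, cnt i = b := by
    have := Finset.card_eq_sum_card_fiberwise (s := range b) (t := univ) (f := cell)
      (by intro x _; simp)
    rw [card_range] at this
    simp only [hcnt]
    exact_mod_cast this.symm
  have h3 : ∑ i, (cnt i - b * w i) = 0 := by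
    rw [Finset.sum_sub_distrib, ← Finset.mul_sum, hw, h2]; ring
  have h4 : ∀ i, |cnt i - b * w i| ≤ 2 * C - (cnt i - b * w i) := by
    intro i
    have := h i
    rw [abs_le]; constructor <;> simp only [hcnt] at * <;> linarith
  rw [h1, Finset.mul_sum, ← Finset.sum_sub_distrib]
  calc _ ≤ ∑ i, |cnt i - b * w i| := by
        refine norm_sum_le_of_le _ fun i _ => ?_
        have : (cnt i : ℂ) * Ψ i - b * ((w i : ℂ) * Ψ i) = ((cnt i - b * w i : ℝ) : ℂ) * Ψ i := by
          push_cast; ring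
        rw [this, norm_mul, Complex.norm_real, Real.norm_eq_abs]
        exact mul_le_of_le_one_right (abs_nonneg _) (hΨ i)
    _ ≤ ∑ i, (2 * C - (cnt i - b * w i)) := Finset.sum_le_sum fun i _ => h4 i
    _ = _ := by rw [Finset.sum_sub_distrib, h3]; simp; ring

/-- The residue of `⌊y⌋` mod `Q` together with the information whether `y` is within `φ` below the
next integer. -/
noncomputable def cellOf (Q : ℕ) (φ y : ℝ) : ZMod Q × Bool :=
  ((⌊y⌋₊ : ZMod Q), decide (1 - φ ≤ Int.fract y))

/-- The proportion of the circle of length `Q` occupied by a cell. -/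
noncomputable def cellWeight (Q : ℕ) (φ : ℝ) (i : ZMod Q × Bool) : ℝ :=
  (if i.2 then φ else 1 - φ) / Q

section Equidistribution

variable {Q : ℕ} [NeZero Q] {b : ℕ} {p : ℤ} {A a φ : ℝ}

lemma sum_cellWeight_mul (Ψ : ZMod Q × Bool → ℂ) :
    ∑ i, (cellWeight Q φ i : ℂ) * Ψ i
      = (1 - φ) * ((∑ z, Ψ (z, false)) / Q) + φ * ((∑ z, Ψ (z, true)) / Q) := by
  rw [Fintype.sum_prod_type]
  simp only [cellWeight, Fintype.sum_bool, Finset.sum_add_distrib]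
  simp only [if_true, Bool.false_eq_true, if_false, ← Finset.mul_sum]
  push_cast
  ring

lemma sum_cellWeight : ∑ i, cellWeight Q φ i = 1 := by
  have hQ : (Q : ℂ) ≠ 0 := by exact_mod_cast NeZero.ne Q
  have := sum_cellWeight_mul (Q := Q) (φ := φ) (fun _ => 1)
  simp only [mul_one, sum_const, card_univ, ZMod.card, nsmul_eq_mul, div_self hQ] at this
  have h2 : ((∑ i, cellWeight Q φ i : ℝ) : ℂ) = 1 := by push_cast; rw [this]; ring
  exact_mod_cast h2

lemma card_cellOf_le (hb : 1 ≤ b) (hp : IsCoprime p (b : ℤ))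
    (ha : |a / Q - p / b| ≤ 1 / (b : ℝ) ^ 2) (hA : 0 ≤ A) (ha0 : 0 ≤ a) (hφ : 0 ≤ φ) (hφ1 : φ ≤ 1)
    (i : ZMod Q × Bool) :
    (((range b).filter fun n : ℕ => cellOf Q φ (A + n * a) = i).card : ℝ)
      ≤ b * cellWeight Q φ i + 3 := by
  have hQ : (0 : ℝ) < Q := by exact_mod_cast Nat.pos_of_ne_zero (NeZero.ne Q)
  obtain ⟨m, β⟩ := i
  have key : ∀ u v : ℝ, u ≤ v → (∀ n : ℕ, cellOf Q φ (A + n * a) = (m, β) →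
      u ≤ Int.fract (A + n * a) ∧ Int.fract (A + n * a) ≤ v) →
      (((range b).filter fun n : ℕ => cellOf Q φ (A + n * a) = (m, β)).card : ℝ)
        ≤ b * ((v - u) / Q) + 3 := by
    intro u v huv h
    have := card_le_of_near_rat hb hp (a := a / Q) (β := A / Q) (u := (m.val + u) / Q)
      (v := (m.val + v) / Q) ha (by gcongr)
      ((range b).filter fun n : ℕ => cellOf Q φ (A + n * a) = (m, β)) (filter_subset _ _) ?_
    · refine this.trans (le_of_eq ?_)
      ring
    · intro n hn
      have hn := (mem_filter.1 hn).2
      obtain ⟨h1, h2⟩ := h n hn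
      have hy : 0 ≤ A + n * a := by positivity
      have hm : (⌊A + n * a⌋₊ : ZMod Q) = m := congrArg Prod.fst hn
      have hm2 : ⌊A + n * a⌋₊ % Q = m.val := by rw [← hm, ZMod.val_natCast]
      refine ⟨((⌊A + n * a⌋₊ / Q : ℕ) : ℤ), ?_⟩
      have h3 : (⌊A + n * a⌋₊ : ℝ) = m.val + Q * (⌊A + n * a⌋₊ / Q : ℕ) := by
        rw [← hm2]; exact_mod_cast (Nat.mod_add_div _ _).symm
      have h4 : A + n * a = ⌊A + n * a⌋₊ + Int.fract (A + n * a) := by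
        rw [natCast_floor_eq_intCast_floor hy, Int.floor_add_fract]
      have h5 : A / Q + n * (a / Q) - (((⌊A + n * a⌋₊ / Q : ℕ) : ℤ) : ℝ)
          = (m.val + Int.fract (A + n * a)) / Q := by
        have : A / Q + n * (a / Q) = (A + n * a) / Q := by ring
        rw [this, Int.cast_natCast, eq_div_iff hQ.ne', sub_mul, div_mul_cancel₀ _ hQ.ne']
        linarith
      rw [h5]
      constructor <;> gcongr
  cases β with
  | true =>
    have := key (1 - φ) 1 (by linarith) fun n hn => by
      have h1 : decide (1 - φ ≤ Int.fract (A + n * a)) = true := congrArg Prod.snd hn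
      exact ⟨of_decide_eq_true h1, (Int.fract_lt_one _).le⟩
    refine this.trans (le_of_eq ?_)
    simp [cellWeight]
  | false =>
    have := key 0 (1 - φ) (by linarith) fun n hn => by
      have h1 : decide (1 - φ ≤ Int.fract (A + n * a)) = false := congrArg Prod.snd hn
      exact ⟨Int.fract_nonneg _, (not_le.1 (of_decide_eq_false h1)).le⟩
    refine this.trans (le_of_eq ?_)
    simp [cellWeight]

lemma norm_sum_range_mul_sub_le (F : ℕ → ℂ) (b m : ℕ) (M : ℂ) (E : ℝ)
    (h : ∀ t, ‖∑ n ∈ range b, F (b * t + n) - b * M‖ ≤ E) :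
    ‖∑ n ∈ range (b * m), F n - (b * m : ℕ) * M‖ ≤ m * E := by
  induction m with
  | zero => simp
  | succ m ih =>
    rw [mul_add, mul_one, Finset.sum_range_add]
    have : ∑ n ∈ range (b * m), F n + ∑ n ∈ range b, F (b * m + n) - ((b * m + b : ℕ) : ℂ) * M
        = (∑ n ∈ range (b * m), F n - (b * m : ℕ) * M)
          + (∑ n ∈ range b, F (b * m + n) - b * M) := by push_cast; ring
    rw [this]
    refine (norm_add_le _ _).trans ?_
    have := h m
    push_cast at ih ⊢
    linarith

/-- Equidistribution of `A + n a` modulo `Q` when `a / Q` is close to a fraction with denominator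
`b`. -/
lemma norm_sum_cellOf_sub_le (hb : 1 ≤ b) (hp : IsCoprime p (b : ℤ))
    (ha : |a / Q - p / b| ≤ 1 / (b : ℝ) ^ 2) (hA : 0 ≤ A) (ha0 : 0 ≤ a) (hφ : 0 ≤ φ) (hφ1 : φ ≤ 1)
    (Ψ : ZMod Q × Bool → ℂ) (hΨ : ∀ i, ‖Ψ i‖ ≤ 1) (H : ℕ) :
    ‖∑ n ∈ range H, Ψ (cellOf Q φ (A + n * a)) - H * ∑ i, (cellWeight Q φ i : ℂ) * Ψ i‖
      ≤ 12 * Q * H / b + 2 * b := by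
  have hb0 : (0 : ℝ) < b := by exact_mod_cast hb
  have hQ : (0 : ℝ) < Q := by exact_mod_cast Nat.pos_of_ne_zero (NeZero.ne Q)
  set M := ∑ i, (cellWeight Q φ i : ℂ) * Ψ i with hM
  have hM1 : ‖M‖ ≤ 1 := by
    rw [← sum_cellWeight (Q := Q) (φ := φ)]
    refine norm_sum_le_of_le _ fun i _ => ?_
    have : 0 ≤ cellWeight Q φ i := by
      unfold cellWeight
      refine div_nonneg ?_ hQ.le
      split_ifs <;> linarith
    rw [norm_mul, Complex.norm_real, Real.norm_eq_abs, abs_of_nonneg this]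
    exact mul_le_of_le_one_right this (hΨ i)
  set F : ℕ → ℂ := fun n => Ψ (cellOf Q φ (A + n * a)) with hF
  have hblock : ∀ t, ‖∑ n ∈ range b, F (b * t + n) - b * M‖ ≤ 12 * Q := by
    intro t
    have := norm_sum_cell_sub_le b (fun n => cellOf Q φ ((A + b * t * a) + n * a))
      (cellWeight Q φ) sum_cellWeight 3 (by norm_num)
      (card_cellOf_le hb hp ha (by positivity) ha0 hφ hφ1) Ψ hΨ
    rw [Fintype.card_prod, ZMod.card, Fintype.card_bool] at this
    refine le_trans (le_of_eq ?_) (this.trans (le_of_eq ?_))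
    · congr 2
      refine Finset.sum_congr rfl fun n _ => ?_
      simp only [hF]
      congr 2
      push_cast; ring
    · push_cast; ring
  have h1 := norm_sum_range_mul_sub_le F b (H / b) M _ hblock
  have hH : H = b * (H / b) + H % b := (Nat.div_add_mod H b).symm
  have hr : ((H % b : ℕ) : ℝ) ≤ b := by exact_mod_cast (Nat.mod_lt H (by omega)).le
  have h2 : ∑ n ∈ range H, F n = ∑ n ∈ range (b * (H / b)), F n
      + ∑ n ∈ range (H % b), F (b * (H / b) + n) := by
    conv_lhs => rw [hH, Finset.sum_range_add]
  have h3 : (H : ℂ) = (b * (H / b) : ℕ) + (H % b : ℕ) := by exact_mod_cast hH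
  have h4 : ‖∑ n ∈ range (H % b), F (b * (H / b) + n)‖ ≤ b := by
    refine (norm_sum_le_of_le _ (fun n _ => hΨ _)).trans ?_
    simpa using hr
  have h5 : ‖((H % b : ℕ) : ℂ) * M‖ ≤ b := by
    rw [norm_mul, Complex.norm_natCast]
    nlinarith [norm_nonneg M]
  have h6 : ((H / b : ℕ) : ℝ) * (12 * Q) ≤ 12 * Q * H / b := by
    have := Nat.cast_div_le (α := ℝ) (m := H) (n := b)
    calc _ ≤ (H / b : ℝ) * (12 * Q) := by gcongr
      _ = _ := by ring
  have h7 : ∑ n ∈ range H, F n - H * M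
      = (∑ n ∈ range (b * (H / b)), F n - (b * (H / b) : ℕ) * M)
        + ∑ n ∈ range (H % b), F (b * (H / b) + n) - ((H % b : ℕ) : ℂ) * M := by
    rw [h2, h3]; ring
  calc ‖∑ n ∈ range H, F n - H * M‖ ≤ ‖∑ n ∈ range (b * (H / b)), F n - (b * (H / b) : ℕ) * M‖
        + ‖∑ n ∈ range (H % b), F (b * (H / b) + n)‖ + ‖((H % b : ℕ) : ℂ) * M‖ := by
        rw [h7]; exact (norm_sub_le _ _).trans (by gcongr; exact norm_add_le _ _)
    _ ≤ _ := by linarith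

/-- Few of the points `A + n a` are just below an integer. -/
lemma card_near_integer_le (hb : 1 ≤ b) (hp : IsCoprime p (b : ℤ))
    (ha : |a / Q - p / b| ≤ 1 / (b : ℝ) ^ 2) (hA : 0 ≤ A) (ha0 : 0 ≤ a) (hφ : 0 ≤ φ) (hφ1 : φ ≤ 1)
    (H : ℕ) :
    (((range H).filter fun n : ℕ => 1 - φ ≤ Int.fract (A + n * a)).card : ℝ)
      ≤ H * φ + (12 * Q * H / b + 2 * b) := by
  have hQ : (Q : ℂ) ≠ 0 := by exact_mod_cast NeZero.ne Q
  have h := norm_sum_cellOf_sub_le hb hp ha hA ha0 hφ hφ1 (fun i => if i.2 then 1 else 0)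
    (by intro i; split_ifs <;> simp) H
  rw [sum_cellWeight_mul] at h
  simp only [Bool.false_eq_true, if_false, if_true, sum_const, card_univ, ZMod.card,
    nsmul_eq_mul, mul_one, mul_zero, zero_div, div_self hQ, zero_add, cellOf,
    decide_eq_true_eq] at h
  rw [Finset.sum_boole] at h
  have h2 : ((((range H).filter fun n : ℕ => 1 - φ ≤ Int.fract (A + n * a)).card : ℂ) - H * φ)
      = (((((range H).filter fun n : ℕ => 1 - φ ≤ Int.fract (A + n * a)).card : ℝ) - H * φ : ℝ) : ℂ)
      := by push_cast; ring
  rw [h2, Complex.norm_real, Real.norm_eq_abs] at h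
  linarith [(abs_le.1 h).2]

/-- Correlations along `A + n a` are controlled by the autocorrelation on `ℤ/Q`. -/
lemma norm_sum_corr_le (hb : 1 ≤ b) (hp : IsCoprime p (b : ℤ))
    (ha : |a / Q - p / b| ≤ 1 / (b : ℝ) ^ 2) (hA : 0 ≤ A) (ha0 : 0 ≤ a) {δ : ℝ} (hδ : 0 ≤ δ)
    (Φ : ZMod Q → ℂ) (hΦ : ∀ z, ‖Φ z‖ ≤ 1) (H : ℕ) :
    ‖∑ n ∈ range H, Φ (⌊A + n * a + δ⌋₊ : ℕ) * conj (Φ (⌊A + n * a⌋₊ : ℕ))‖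
      ≤ H * ((‖corr Φ (⌊δ⌋₊ : ℕ)‖ + ‖corr Φ (⌊δ⌋₊ + 1 : ℕ)‖) / Q)
        + (12 * Q * H / b + 2 * b) := by
  have hQ : (0 : ℝ) < Q := by exact_mod_cast Nat.pos_of_ne_zero (NeZero.ne Q)
  set Ψ : ZMod Q × Bool → ℂ := fun i =>
    Φ (i.1 + if i.2 then ((⌊δ⌋₊ + 1 : ℕ) : ZMod Q) else ((⌊δ⌋₊ : ℕ) : ZMod Q)) * conj (Φ i.1) with hΨ
  have hφ := Int.fract_nonneg δ
  have hφ1 := (Int.fract_lt_one δ).le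
  have h := norm_sum_cellOf_sub_le hb hp ha hA ha0 hφ hφ1 Ψ
    (by
      intro i
      simp only [hΨ, norm_mul, RCLike.norm_conj]
      exact mul_le_one₀ (hΦ _) (norm_nonneg _) (hΦ _)) H
  rw [sum_cellWeight_mul] at h
  have e1 : ∑ n ∈ range H, Φ (⌊A + n * a + δ⌋₊ : ℕ) * conj (Φ (⌊A + n * a⌋₊ : ℕ))
      = ∑ n ∈ range H, Ψ (cellOf Q (Int.fract δ) (A + n * a)) := by
    refine Finset.sum_congr rfl fun n _ => ?_
    have hy : 0 ≤ A + n * a := by positivity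
    simp only [hΨ, cellOf, decide_eq_true_eq]
    congr 2
    have f1 : A + n * a = ⌊A + n * a⌋₊ + Int.fract (A + n * a) := by
      rw [natCast_floor_eq_intCast_floor hy, Int.floor_add_fract]
    have f2 : δ = ⌊δ⌋₊ + Int.fract δ := by
      rw [natCast_floor_eq_intCast_floor hδ, Int.floor_add_fract]
    have g1 := Int.fract_nonneg (A + n * a)
    have g2 := Int.fract_lt_one (A + n * a)
    have g3 := Int.fract_lt_one δ
    split_ifs with hc
    · rw [← Nat.cast_add]
      congr 1
      rw [Nat.floor_eq_iff (by positivity)]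
      push_cast
      constructor <;> linarith
    · rw [← Nat.cast_add]
      congr 1
      rw [Nat.floor_eq_iff (by positivity)]
      push_cast
      constructor <;> linarith
  have e2 : (∑ z, Ψ (z, false)) = corr Φ (⌊δ⌋₊ : ℕ) := by simp [hΨ, corr]
  have e3 : (∑ z, Ψ (z, true)) = corr Φ (⌊δ⌋₊ + 1 : ℕ) := by simp [hΨ, corr]
  rw [e1]
  rw [e2, e3] at h
  have e4 : ‖(H : ℂ) * ((1 - (Int.fract δ : ℝ)) * (corr Φ (⌊δ⌋₊ : ℕ) / Q)
      + (Int.fract δ : ℝ) * (corr Φ (⌊δ⌋₊ + 1 : ℕ) / Q))‖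
      ≤ H * ((‖corr Φ (⌊δ⌋₊ : ℕ)‖ + ‖corr Φ (⌊δ⌋₊ + 1 : ℕ)‖) / Q) := by
    rw [norm_mul, Complex.norm_natCast, add_div]
    gcongr
    refine (norm_add_le _ _).trans ?_
    have k1 : ‖(1 - (Int.fract δ : ℝ) : ℂ)‖ ≤ 1 := by
      have : (1 - (Int.fract δ : ℝ) : ℂ) = ((1 - Int.fract δ : ℝ) : ℂ) := by push_cast; rfl
      rw [this, Complex.norm_real, Real.norm_eq_abs, abs_of_nonneg (by linarith)]; linarith
    have k2 : ‖((Int.fract δ : ℝ) : ℂ)‖ ≤ 1 := by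
      rw [Complex.norm_real, Real.norm_eq_abs, abs_of_nonneg (by linarith)]; linarith
    rw [norm_mul, norm_mul, norm_div, norm_div, Complex.norm_natCast]
    exact add_le_add (mul_le_of_le_one_left (by positivity) k1)
      (mul_le_of_le_one_left (by positivity) k2)
  calc _ ≤ _ := norm_le_norm_add_norm_sub' _ _
    _ ≤ _ := add_le_add e4 h

end Equidistribution

/-- Autocorrelations of products over coprime moduli are bounded by the first factor. -/
lemma norm_corr_mul_le {Q₁ Q₂ : ℕ} [NeZero Q₁] [NeZero Q₂] [NeZero (Q₁ * Q₂)]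
    (hQ : Nat.Coprime Q₁ Q₂) (Φ₁ : ZMod Q₁ → ℂ) (Φ₂ : ZMod Q₂ → ℂ) (h₂ : ∀ z, ‖Φ₂ z‖ ≤ 1) (d : ℕ) :
    ‖corr (fun z : ZMod (Q₁ * Q₂) => Φ₁ z.cast * Φ₂ z.cast) (d : ZMod (Q₁ * Q₂))‖
      ≤ Q₂ * ‖corr Φ₁ d‖ := by
  have h : corr (fun z : ZMod (Q₁ * Q₂) => Φ₁ z.cast * Φ₂ z.cast) (d : ZMod (Q₁ * Q₂))
      = corr Φ₁ d * corr Φ₂ d := by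
    have e1 : ∀ z : ZMod (Q₁ * Q₂), (ZMod.chineseRemainder hQ z) = (z.cast, z.cast) := by
      intro z
      conv_lhs => rw [← ZMod.natCast_zmod_val z]
      rw [map_natCast]
      ext <;> simp [ZMod.natCast_val]
    have e2 : corr (fun z : ZMod (Q₁ * Q₂) => Φ₁ z.cast * Φ₂ z.cast) (d : ZMod (Q₁ * Q₂))
        = ∑ z : ZMod (Q₁ * Q₂), (fun y : ZMod Q₁ × ZMod Q₂ =>
            (Φ₁ (y.1 + d) * conj (Φ₁ y.1)) * (Φ₂ (y.2 + d) * conj (Φ₂ y.2)))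
              (ZMod.chineseRemainder hQ z) := by
      refine Finset.sum_congr rfl fun z _ => ?_
      have e3 := e1 (z + d)
      rw [map_add, map_natCast, e1 z] at e3
      have e4 := congrArg Prod.fst e3
      have e5 := congrArg Prod.snd e3
      simp only [Prod.fst_add, Prod.snd_add, Prod.fst_natCast, Prod.snd_natCast] at e4 e5
      rw [e1 z]
      dsimp only
      rw [← e4, ← e5, map_mul]
      ring
    rw [e2]
    refine (Equiv.sum_comp (ZMod.chineseRemainder hQ).toEquiv (fun y : ZMod Q₁ × ZMod Q₂ =>
      (Φ₁ (y.1 + d) * conj (Φ₁ y.1)) * (Φ₂ (y.2 + d) * conj (Φ₂ y.2)))).trans ?_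
    rw [corr, corr, Finset.sum_mul_sum, Fintype.sum_prod_type]
  rw [h, norm_mul, mul_comm]
  gcongr
  refine (norm_sum_le_of_le _ (n := fun _ => (1 : ℝ)) fun t _ => ?_).trans (by simp [ZMod.card])
  rw [norm_mul, RCLike.norm_conj]
  exact mul_le_one₀ (h₂ _) (norm_nonneg _) (h₂ _)

lemma norm_sum_sub_sum_shift_le (F : ℕ → ℂ) (hF : ∀ n, ‖F n‖ ≤ 1) (H k : ℕ) :
    ‖∑ n ∈ range H, F n - ∑ n ∈ range H, F (n + k)‖ ≤ 2 * k := by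
  have h1 := Finset.sum_range_add F H k
  have h2 := Finset.sum_range_add F k H
  rw [add_comm k H, h1] at h2
  have h3 : ∑ n ∈ range H, F n - ∑ n ∈ range H, F (n + k)
      = ∑ i ∈ range k, F i - ∑ i ∈ range k, F (H + i) := by
    simp_rw [add_comm _ k]
    linear_combination h2
  rw [h3]
  have hk : ∀ g : ℕ → ℕ, ‖∑ i ∈ range k, F (g i)‖ ≤ k := fun g =>
    (norm_sum_le_of_le _ fun i _ => hF (g i)).trans (by simp)
  refine (norm_sub_le _ _).trans ?_
  have e1 : ‖∑ i ∈ range k, F i‖ ≤ k := hk fun i => i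
  have e2 : ‖∑ i ∈ range k, F (H + i)‖ ≤ k := hk fun i => H + i
  linarith

/-- A sum of bounded terms is controlled by its averages over short windows. -/
lemma norm_sum_le_average (F : ℕ → ℂ) (hF : ∀ n, ‖F n‖ ≤ 1) (H : ℕ) {L : ℕ} (hL : 1 ≤ L) :
    ‖∑ n ∈ range H, F n‖ ≤ 2 * L + (∑ n ∈ range H, ‖∑ k ∈ range L, F (n + k)‖) / L := by
  have hL0 : (0 : ℝ) < L := by exact_mod_cast hL
  have h1 : ‖∑ k ∈ range L, (∑ n ∈ range H, F n - ∑ n ∈ range H, F (n + k))‖ ≤ 2 * L * L := by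
    refine (norm_sum_le_of_le _ (n := fun _ => (2 * L : ℝ)) fun k hk => ?_).trans
      (by simp; linarith)
    refine (norm_sum_sub_sum_shift_le F hF H k).trans ?_
    have : (k : ℝ) ≤ L := by exact_mod_cast (mem_range.1 hk).le
    linarith
  set S := ∑ n ∈ range H, F n with hS
  set W := ∑ n ∈ range H, ∑ k ∈ range L, F (n + k) with hW
  have h2 : ∑ k ∈ range L, (S - ∑ n ∈ range H, F (n + k)) = L * S - W := by
    rw [Finset.sum_sub_distrib, sum_const, card_range, nsmul_eq_mul, hW]
    congr 1
    exact Finset.sum_comm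
  rw [h2] at h1
  have h3 : ‖W‖ ≤ ∑ n ∈ range H, ‖∑ k ∈ range L, F (n + k)‖ := norm_sum_le _ _
  have h4 : ‖(L : ℂ) * S‖ ≤ ‖W‖ + ‖(L : ℂ) * S - W‖ := norm_le_norm_add_norm_sub' _ _
  rw [norm_mul, Complex.norm_natCast] at h4
  rw [← sub_le_iff_le_add', le_div_iff₀ hL0]
  linarith

/-- A monotone sequence is constant on most short windows. -/
lemma card_not_constant_le (D : ℕ → ℕ) (hD : Monotone D) (H L : ℕ) :
    (((range H).filter fun n => ∃ k < L, D (n + k) ≠ D n).card : ℝ)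
      ≤ L * ((D (H + L) : ℝ) - D 0) := by
  have h1 : (((range H).filter fun n => ∃ k < L, D (n + k) ≠ D n).card : ℝ)
      ≤ ∑ n ∈ range H, ((D (n + L) : ℝ) - D n) := by
    rw [Finset.card_filter, Nat.cast_sum]
    refine Finset.sum_le_sum fun n _ => ?_
    have hm : D n ≤ D (n + L) := hD (by omega)
    split_ifs with h
    · obtain ⟨k, hk, hne⟩ := h
      have e1 : D n ≤ D (n + k) := hD (by omega)
      have e2 : D (n + k) ≤ D (n + L) := hD (by omega)
      have : D n + 1 ≤ D (n + L) := by omega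
      have : (D n : ℝ) + 1 ≤ D (n + L) := by exact_mod_cast this
      push_cast; linarith
    · have : (D n : ℝ) ≤ D (n + L) := by exact_mod_cast hm
      push_cast; linarith
  refine h1.trans ?_
  have h2 := Finset.sum_range_add (fun n => (D n : ℝ)) H L
  have h3 := Finset.sum_range_add (fun n => (D n : ℝ)) L H
  rw [add_comm L H, h2] at h3
  simp_rw [add_comm L] at h3
  rw [Finset.sum_sub_distrib]
  have h4 : ∑ n ∈ range L, (D (H + n) : ℝ) ≤ L * D (H + L) := by
    refine (Finset.sum_le_card_nsmul _ _ (D (H + L) : ℝ) fun n hn => ?_).trans (by simp)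
    exact_mod_cast hD (by have := mem_range.1 hn; omega)
  have h5 : (L : ℝ) * D 0 ≤ ∑ n ∈ range L, (D n : ℝ) := by
    refine le_trans (by simp) (Finset.card_nsmul_le_sum _ _ (D 0 : ℝ) fun n hn => ?_)
    exact_mod_cast hD (by omega)
  linarith

lemma sum_normSq_window_le (G : ℕ → ℂ) (H L : ℕ) :
    ∑ n ∈ range H, ‖∑ k ∈ range L, G (n + k)‖ ^ 2
      ≤ ∑ k ∈ range L, ∑ k' ∈ range L, ‖∑ n ∈ range H, G (n + k) * conj (G (n + k'))‖ := by
  have h : ((∑ n ∈ range H, ‖∑ k ∈ range L, G (n + k)‖ ^ 2 : ℝ) : ℂ)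
      = ∑ k ∈ range L, ∑ k' ∈ range L, ∑ n ∈ range H, G (n + k) * conj (G (n + k')) := by
    have e : ∀ n, ((‖∑ k ∈ range L, G (n + k)‖ ^ 2 : ℝ) : ℂ)
        = ∑ k ∈ range L, ∑ k' ∈ range L, G (n + k) * conj (G (n + k')) := by
      intro n
      rw [← Complex.normSq_eq_norm_sq, ← Complex.mul_conj, map_sum, Finset.sum_mul_sum]
    rw [Complex.ofReal_sum]
    simp_rw [e]
    rw [Finset.sum_comm]
    refine Finset.sum_congr rfl fun k _ => ?_
    rw [Finset.sum_comm]
  have h0 : 0 ≤ ∑ n ∈ range H, ‖∑ k ∈ range L, G (n + k)‖ ^ 2 := by positivity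
  rw [← abs_of_nonneg h0, ← Real.norm_eq_abs, ← Complex.norm_real, h]
  exact (norm_sum_le _ _).trans (Finset.sum_le_sum fun k _ => norm_sum_le _ _)

section Linear

variable {Q₁ Q₂ : ℕ} [NeZero (Q₁ * Q₂)] {b : ℕ} {p : ℤ} {A a : ℝ}

/-- The bound for the correlation at distance `j` of a function on `ℤ/Q` along slope `a`. -/
noncomputable def slopeCorr {Q : ℕ} [NeZero Q] (Φ : ZMod Q → ℂ) (a : ℝ) (j : ℕ) : ℝ :=
  (‖corr Φ (⌊j * a⌋₊ : ℕ)‖ + ‖corr Φ (⌊j * a⌋₊ + 1 : ℕ)‖) / Q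

lemma slopeCorr_nonneg {Q : ℕ} [NeZero Q] (Φ : ZMod Q → ℂ) (a : ℝ) (j : ℕ) :
    0 ≤ slopeCorr Φ a j := by unfold slopeCorr; positivity

lemma sum_normSq_window_linear_le {Q : ℕ} [NeZero Q] (hb : 1 ≤ b) (hp : IsCoprime p (b : ℤ))
    (ha : |a / Q - p / b| ≤ 1 / (b : ℝ) ^ 2) (hA : 0 ≤ A) (ha0 : 0 ≤ a)
    (Φ : ZMod Q → ℂ) (hΦ : ∀ z, ‖Φ z‖ ≤ 1) (H L : ℕ) :
    ∑ n ∈ range H, ‖∑ k ∈ range L, Φ (⌊A + (n + k : ℕ) * a⌋₊ : ℕ)‖ ^ 2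
      ≤ L * H + L ^ 2 * (12 * Q * H / b + 2 * b)
        + H * ∑ x ∈ (range L).offDiag, slopeCorr Φ a ((x.1 - x.2) + (x.2 - x.1)) := by
  set E : ℝ := 12 * Q * H / b + 2 * b with hE
  have hE0 : 0 ≤ E := by positivity
  set G : ℕ → ℂ := fun n => Φ (⌊A + n * a⌋₊ : ℕ) with hG
  have hG1 : ∀ n, ‖G n‖ ≤ 1 := fun n => hΦ _
  have hlt : ∀ k' j, ‖∑ n ∈ range H, G (n + (k' + j)) * conj (G (n + k'))‖
      ≤ H * slopeCorr Φ a j + E := by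
    intro k' j
    have := norm_sum_corr_le hb hp ha (A := A + k' * a) (by positivity) ha0 (δ := j * a)
      (by positivity) Φ hΦ H
    refine le_trans (le_of_eq ?_) this
    congr 1
    refine Finset.sum_congr rfl fun n _ => ?_
    simp only [hG]
    have i1 : A + (n + (k' + j) : ℕ) * a = A + k' * a + n * a + j * a := by push_cast; ring
    have i2 : A + (n + k' : ℕ) * a = A + k' * a + n * a := by push_cast; ring
    rw [i1, i2]
  have hoff : ∀ x : ℕ × ℕ, ‖∑ n ∈ range H, G (n + x.1) * conj (G (n + x.2))‖
      ≤ H * slopeCorr Φ a ((x.1 - x.2) + (x.2 - x.1)) + E := by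
    rintro ⟨k, k'⟩
    rcases le_total k' k with h | h
    · obtain ⟨j, rfl⟩ := Nat.exists_eq_add_of_le h
      have : (k' + j - k') + (k' - (k' + j)) = j := by omega
      simpa only [this] using hlt k' j
    · obtain ⟨j, rfl⟩ := Nat.exists_eq_add_of_le h
      have : (k - (k + j)) + (k + j - k) = j := by omega
      simp only [this]
      refine le_trans (le_of_eq ?_) (hlt k j)
      rw [← RCLike.norm_conj, map_sum]
      congr 1
      refine Finset.sum_congr rfl fun n _ => ?_
      rw [map_mul, Complex.conj_conj, mul_comm]
  refine (sum_normSq_window_le G H L).trans ?_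
  rw [← Finset.sum_product', ← Finset.diag_union_offDiag, Finset.sum_union (Finset.disjoint_diag_offDiag _)]
  have hd : ∑ x ∈ (range L).diag, ‖∑ n ∈ range H, G (n + x.1) * conj (G (n + x.2))‖ ≤ L * H := by
    rw [Finset.sum_diag]
    refine (Finset.sum_le_card_nsmul _ _ (H : ℝ) fun k _ => ?_).trans (by simp)
    refine (norm_sum_le_of_le _ (n := fun _ => (1 : ℝ)) fun n _ => ?_).trans (by simp)
    rw [norm_mul, RCLike.norm_conj]
    exact mul_le_one₀ (hG1 _) (norm_nonneg _) (hG1 _)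
  have ho : ∑ x ∈ (range L).offDiag, ‖∑ n ∈ range H, G (n + x.1) * conj (G (n + x.2))‖
      ≤ H * ∑ x ∈ (range L).offDiag, slopeCorr Φ a ((x.1 - x.2) + (x.2 - x.1)) + L ^ 2 * E := by
    refine (Finset.sum_le_sum fun x _ => hoff x).trans ?_
    rw [Finset.sum_add_distrib, ← Finset.mul_sum]
    gcongr
    rw [sum_const, nsmul_eq_mul]
    gcongr
    rw [Finset.offDiag_card, card_range, ← sq]
    exact_mod_cast Nat.sub_le _ _
  linarith

lemma card_quotient_changes_le (hA : 0 ≤ A) (ha0 : 0 ≤ a) {Q : ℕ} (hQ : 1 ≤ Q) (H L : ℕ) :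
    (((range H).filter fun n : ℕ => ∃ k < L,
      ⌊A + (n + k : ℕ) * a⌋₊ / Q ≠ ⌊A + n * a⌋₊ / Q).card : ℝ) ≤ L * (a * (H + L) / Q + 1) := by
  have hQ0 : (0 : ℝ) < Q := by exact_mod_cast hQ
  have hmono : Monotone fun n : ℕ => ⌊A + n * a⌋₊ / Q := by
    intro n m h
    have : (n : ℝ) ≤ m := by exact_mod_cast h
    exact Nat.div_le_div_right (Nat.floor_mono (by gcongr))
  refine (card_not_constant_le _ hmono H L).trans ?_
  gcongr
  rw [← Nat.floor_div_natCast, ← Nat.floor_div_natCast]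
  have h1 := Nat.floor_le (show 0 ≤ (A + (H + L : ℕ) * a) / Q by positivity)
  have h2 := Nat.lt_floor_add_one ((A + (0 : ℕ) * a) / Q)
  push_cast at h1 h2 ⊢
  have h3 : (A + (H + L) * a) / Q - (A + 0 * a) / Q = a * (H + L) / Q := by ring
  linarith

/-- Bound for a digital-type function along a linear sequence with well-distributed slope. -/
lemma norm_sum_linear_le (hQ₁ : 1 ≤ Q₁) (hQ₂ : 1 ≤ Q₂) (hb : 1 ≤ b) (hp : IsCoprime p (b : ℤ))
    (ha : |a / (Q₁ * Q₂ : ℕ) - p / b| ≤ 1 / (b : ℝ) ^ 2) (hA : 0 ≤ A) (ha0 : 0 ≤ a)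
    (Φ : ZMod (Q₁ * Q₂) → ℂ) (hΦ : ∀ z, ‖Φ z‖ ≤ 1) (e₁ e₂ : ℕ → ℂ) (he₁ : ∀ n, ‖e₁ n‖ ≤ 1)
    (he₂ : ∀ n, ‖e₂ n‖ ≤ 1) (f : ℕ → ℂ) (hf : ∀ n : ℕ, f n = e₁ (n / Q₁) * e₂ (n / Q₂) * Φ n)
    (H : ℕ) {T : ℕ} (hT : 1 ≤ T) :
    ‖∑ n ∈ range H, f ⌊A + n * a⌋₊‖ ≤ 2 * T ^ 2
      + T ^ 2 * (a * (H + T ^ 2) / Q₁ + 1) + T ^ 2 * (a * (H + T ^ 2) / Q₂ + 1) + H / T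
      + T * (12 * (Q₁ * Q₂ : ℕ) * H / b + 2 * b)
      + H / T ^ 3 * ∑ x ∈ (range (T ^ 2)).offDiag, slopeCorr Φ a ((x.1 - x.2) + (x.2 - x.1)) := by
  have hT0 : (0 : ℝ) < T := by exact_mod_cast hT
  set L := T ^ 2 with hL
  have hL1 : 1 ≤ L := Nat.one_le_pow _ _ hT
  have hLr : (L : ℝ) = (T : ℝ) ^ 2 := by rw [hL]; push_cast; rfl
  have hL0 : (0 : ℝ) < L := by exact_mod_cast hL1
  set F : ℕ → ℂ := fun n => f ⌊A + n * a⌋₊ with hF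
  set G : ℕ → ℂ := fun n => Φ (⌊A + n * a⌋₊ : ℕ) with hG
  set E : ℝ := 12 * (Q₁ * Q₂ : ℕ) * H / b + 2 * b with hE
  have hE0 : 0 ≤ E := by positivity
  set Γ := ∑ x ∈ (range L).offDiag, slopeCorr Φ a ((x.1 - x.2) + (x.2 - x.1)) with hΓ
  have hΓ0 : 0 ≤ Γ := Finset.sum_nonneg fun _ _ => slopeCorr_nonneg _ _ _
  have hF1 : ∀ n, ‖F n‖ ≤ 1 := by
    intro n
    simp only [hF, hf, norm_mul]
    exact mul_le_one₀ (mul_le_one₀ (he₁ _) (norm_nonneg _) (he₂ _)) (norm_nonneg _) (hΦ _)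
  set bad₁ := (range H).filter fun n : ℕ => ∃ k < L,
      ⌊A + (n + k : ℕ) * a⌋₊ / Q₁ ≠ ⌊A + n * a⌋₊ / Q₁ with hbad₁
  set bad₂ := (range H).filter fun n : ℕ => ∃ k < L,
      ⌊A + (n + k : ℕ) * a⌋₊ / Q₂ ≠ ⌊A + n * a⌋₊ / Q₂ with hbad₂
  have hwin : ∀ n ∈ range H, ‖∑ k ∈ range L, F (n + k)‖ / L ≤ (if n ∈ bad₁ then 1 else 0)
      + (if n ∈ bad₂ then 1 else 0) + (1 / (2 * T)
        + T / (2 * L ^ 2) * ‖∑ k ∈ range L, G (n + k)‖ ^ 2) := by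
    intro n hn
    have htriv : ‖∑ k ∈ range L, F (n + k)‖ / L ≤ 1 := by
      rw [div_le_one hL0]
      exact (norm_sum_le_of_le _ fun k _ => hF1 _).trans (by simp)
    have hpos : 0 ≤ 1 / (2 * T) + T / (2 * L ^ 2) * ‖∑ k ∈ range L, G (n + k)‖ ^ 2 := by positivity
    by_cases h1 : n ∈ bad₁
    · rw [if_pos h1]; split_ifs <;> linarith
    by_cases h2 : n ∈ bad₂
    · rw [if_pos h2]; split_ifs; linarith
    rw [if_neg h1, if_neg h2]
    simp only [hbad₁, hbad₂, mem_filter, hn, true_and, not_exists, not_and, not_not] at h1 h2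
    have hFG : ∑ k ∈ range L, F (n + k)
        = (e₁ (⌊A + n * a⌋₊ / Q₁) * e₂ (⌊A + n * a⌋₊ / Q₂)) * ∑ k ∈ range L, G (n + k) := by
      rw [Finset.mul_sum]
      refine Finset.sum_congr rfl fun k hk => ?_
      simp only [hF, hG]
      rw [hf, h1 k (mem_range.1 hk), h2 k (mem_range.1 hk)]
    have hle : ‖∑ k ∈ range L, F (n + k)‖ ≤ ‖∑ k ∈ range L, G (n + k)‖ := by
      rw [hFG, norm_mul, norm_mul]
      exact mul_le_of_le_one_left (norm_nonneg _) (mul_le_one₀ (he₁ _) (norm_nonneg _) (he₂ _))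
    set r := ‖∑ k ∈ range L, G (n + k)‖ / L with hr
    have hr2 : T / (2 * L ^ 2) * ‖∑ k ∈ range L, G (n + k)‖ ^ 2 = T * r ^ 2 / 2 := by
      rw [hr]; field_simp
    have hamgm : r ≤ 1 / (2 * T) + T * r ^ 2 / 2 := by
      have : 1 / (2 * T) + T * r ^ 2 / 2 - r = (T * r - 1) ^ 2 / (2 * T) := by
        field_simp; ring
      have h3 : 0 ≤ (T * r - 1) ^ 2 / (2 * T) := by positivity
      linarith
    rw [hr2]
    calc _ ≤ r := by rw [hr]; gcongr
      _ ≤ _ := by linarith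
  have hvar := sum_normSq_window_linear_le hb hp ha hA ha0 Φ hΦ H L
  have hb1 := card_quotient_changes_le hA ha0 hQ₁ H L
  have hb2 := card_quotient_changes_le hA ha0 hQ₂ H L
  have hsum := Finset.sum_le_sum hwin
  rw [Finset.sum_add_distrib, Finset.sum_add_distrib, Finset.sum_add_distrib, ← Finset.sum_div,
    ← Finset.mul_sum, Finset.sum_boole, Finset.sum_boole, Finset.filter_mem_eq_inter,
    Finset.filter_mem_eq_inter, Finset.inter_eq_right.2 (filter_subset _ _),
    Finset.inter_eq_right.2 (filter_subset _ _), sum_const, card_range, nsmul_eq_mul] at hsum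
  have hmain := norm_sum_le_average F hF1 H hL1
  have hscaled : T / (2 * L ^ 2) * ∑ n ∈ range H, ‖∑ k ∈ range L, G (n + k)‖ ^ 2
      ≤ H / (2 * T) + T * E / 2 + H / (2 * T ^ 3) * Γ := by
    calc _ ≤ T / (2 * L ^ 2) * (L * H + L ^ 2 * E + H * Γ) := by gcongr
      _ = _ := by rw [hLr]; field_simp
  have hh : (H : ℝ) * (1 / (2 * T)) + H / (2 * T) = H / T := by field_simp; ring
  have hΓ2 : H / (2 * T ^ 3) * Γ ≤ H / T ^ 3 * Γ := by
    gcongr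
    have : (0 : ℝ) < T ^ 3 := by positivity
    linarith
  have hTE : T * E / 2 ≤ T * E := by
    have : 0 ≤ T * E := by positivity
    linarith
  rw [hLr] at hmain hb1 hb2
  rw [← hbad₁] at hb1
  rw [← hbad₂] at hb2
  rw [hLr] at hsum hscaled
  linarith

end Linear

lemma rpow_add_bounds {c : ℝ} (hc : 1 < c) (hc' : c < 18 / 17) {N n : ℝ} (hN : 1 ≤ N) (hn : 0 ≤ n) :
    N ^ c + n * (c * N ^ (c - 1)) ≤ (N + n) ^ c ∧
    (N + n) ^ c ≤ N ^ c + n * (c * N ^ (c - 1)) + N ^ (c - 2) * n ^ 2 := by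
  have hN0 : 0 < N := by linarith
  have ht : 0 ≤ n / N := by positivity
  have e1 : (N + n) ^ c = N ^ c * (1 + n / N) ^ c := by
    rw [← Real.mul_rpow hN0.le (by positivity)]; congr 1; field_simp
  have e2 : N ^ c = N ^ (c - 1) * N := by
    rw [← Real.rpow_add_one hN0.ne']; congr 1; ring
  have e3 : N ^ (c - 1) = N ^ (c - 2) * N := by
    rw [← Real.rpow_add_one hN0.ne']; congr 1; ring
  have hNc : 0 < N ^ c := by positivity
  have hNc2 : 0 < N ^ (c - 2) := by positivity
  constructor
  · have h := one_add_mul_self_le_rpow_one_add (s := n / N) (by linarith) hc.le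
    rw [e1]
    calc _ = N ^ c * (1 + c * (n / N)) := by rw [e2]; field_simp
      _ ≤ _ := by gcongr
  · have h := rpow_one_add_le_one_add_mul_self (s := n / N) (by linarith) (p := c - 1)
      (by linarith) (by linarith)
    have h2 : (1 + n / N) ^ c = (1 + n / N) ^ (c - 1) * (1 + n / N) := by
      rw [← Real.rpow_add_one (by positivity)]; congr 1; ring
    rw [e1, h2]
    calc _ ≤ N ^ c * ((1 + (c - 1) * (n / N)) * (1 + n / N)) := by gcongr
      _ = N ^ c + n * (c * N ^ (c - 1)) + (c - 1) * (N ^ (c - 2) * n ^ 2) := by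
        rw [e2, e3]; field_simp; ring
      _ ≤ _ := by
        have : 0 ≤ N ^ (c - 2) * n ^ 2 := by positivity
        nlinarith

/-- Bound for a digital-type function along `n ^ c` on a short interval. -/
lemma norm_sum_segment_le {Q₁ Q₂ : ℕ} [NeZero (Q₁ * Q₂)] {b : ℕ} {p : ℤ} {c : ℝ} (hc : 1 < c)
    (hc' : c < 18 / 17) {N : ℝ} (hN : 1 ≤ N)
    (hQ₁ : 1 ≤ Q₁) (hQ₂ : 1 ≤ Q₂) (hb : 1 ≤ b) (hp : IsCoprime p (b : ℤ))
    (ha : |c * N ^ (c - 1) / (Q₁ * Q₂ : ℕ) - p / b| ≤ 1 / (b : ℝ) ^ 2)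
    (Φ : ZMod (Q₁ * Q₂) → ℂ) (hΦ : ∀ z, ‖Φ z‖ ≤ 1) (e₁ e₂ : ℕ → ℂ) (he₁ : ∀ n, ‖e₁ n‖ ≤ 1)
    (he₂ : ∀ n, ‖e₂ n‖ ≤ 1) (f : ℕ → ℂ) (hf : ∀ n : ℕ, f n = e₁ (n / Q₁) * e₂ (n / Q₂) * Φ n)
    (H : ℕ) {T : ℕ} (hT : 1 ≤ T) (hη : N ^ (c - 2) * H ^ 2 ≤ 1) :
    ‖∑ n ∈ range H, f ⌊(N + n) ^ c⌋₊‖ ≤ 2 * T ^ 2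
      + T ^ 2 * (c * N ^ (c - 1) * (H + T ^ 2) / Q₁ + 1)
      + T ^ 2 * (c * N ^ (c - 1) * (H + T ^ 2) / Q₂ + 1) + H / T
      + (T + 2) * (12 * (Q₁ * Q₂ : ℕ) * H / b + 2 * b) + 2 * H * (N ^ (c - 2) * H ^ 2)
      + H / T ^ 3 * ∑ x ∈ (range (T ^ 2)).offDiag,
          slopeCorr Φ (c * N ^ (c - 1)) ((x.1 - x.2) + (x.2 - x.1)) := by
  have hN0 : 0 < N := by linarith
  set a := c * N ^ (c - 1) with ha_def
  set A := N ^ c with hA_def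
  set η := N ^ (c - 2) * (H : ℝ) ^ 2 with hη_def
  have ha0 : 0 ≤ a := by positivity
  have hA0 : 0 ≤ A := by positivity
  have hη0 : 0 ≤ η := by positivity
  have hf1 : ∀ n, ‖f n‖ ≤ 1 := by
    intro n
    simp only [hf, norm_mul]
    exact mul_le_one₀ (mul_le_one₀ (he₁ _) (norm_nonneg _) (he₂ _)) (norm_nonneg _) (hΦ _)
  have hlin := norm_sum_linear_le hQ₁ hQ₂ hb hp ha hA0 ha0 Φ hΦ e₁ e₂ he₁ he₂ f hf H hT
  have hcard := card_near_integer_le hb hp ha hA0 ha0 hη0 hη H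
  have hdiff : ‖∑ n ∈ range H, f ⌊(N + n) ^ c⌋₊ - ∑ n ∈ range H, f ⌊A + n * a⌋₊‖
      ≤ 2 * (((range H).filter fun n : ℕ => 1 - η ≤ Int.fract (A + n * a)).card : ℝ) := by
    rw [← Finset.sum_sub_distrib, Finset.card_filter, Nat.cast_sum, Finset.mul_sum]
    refine norm_sum_le_of_le _ fun n hn => ?_
    obtain ⟨h1, h2⟩ := rpow_add_bounds hc hc' hN (Nat.cast_nonneg n)
    have hnH : (n : ℝ) ≤ H := by exact_mod_cast (mem_range.1 hn).le
    have h3 : N ^ (c - 2) * (n : ℝ) ^ 2 ≤ η := by rw [hη_def]; gcongr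
    split_ifs with h
    · refine (norm_sub_le _ _).trans ?_
      push_cast
      linarith [hf1 ⌊(N + n) ^ c⌋₊, hf1 ⌊A + n * a⌋₊]
    · push Not at h
      have : ⌊(N + n) ^ c⌋₊ = ⌊A + n * a⌋₊ := by
        rw [Nat.floor_eq_iff (by positivity)]
        have f1 : A + n * a = ⌊A + n * a⌋₊ + Int.fract (A + n * a) := by
          rw [natCast_floor_eq_intCast_floor (by positivity), Int.floor_add_fract]
        have f2 := Int.fract_nonneg (A + n * a)
        constructor <;> linarith
      rw [this]; simp
  have := norm_le_norm_add_norm_sub' (∑ n ∈ range H, f ⌊(N + n) ^ c⌋₊) (∑ n ∈ range H, f ⌊A + n * a⌋₊)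
  linarith

lemma sum_range_eq_sum_blocks (F : ℕ → ℂ) (H M : ℕ) :
    ∑ j ∈ range (M * H), F j = ∑ k ∈ range M, ∑ i ∈ range H, F (k * H + i) := by
  induction M with
  | zero => simp
  | succ M ih => rw [Nat.succ_mul, Finset.sum_range_add, ih, Finset.sum_range_succ]

lemma norm_sum_le_sum_blocks (F : ℕ → ℂ) (hF : ∀ n, ‖F n‖ ≤ 1) {H : ℕ} (hH : 1 ≤ H) (J : ℕ) :
    ‖∑ j ∈ range J, F j‖ ≤ ∑ k ∈ range (J / H), ‖∑ i ∈ range H, F (k * H + i)‖ + H := by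
  have hJ : J = J / H * H + J % H := by rw [mul_comm]; exact (Nat.div_add_mod J H).symm
  conv_lhs => rw [hJ]
  rw [Finset.sum_range_add, sum_range_eq_sum_blocks]
  refine (norm_add_le _ _).trans (add_le_add (norm_sum_le _ _) ?_)
  refine (norm_sum_le_of_le _ (n := fun _ => (1 : ℝ)) fun n _ => hF _).trans ?_
  have := (Nat.mod_lt J hH).le
  simpa using this

/-- A well-spaced sequence has few terms in an interval. -/
lemma card_le_of_spaced {S : Finset ℕ} {a : ℕ → ℝ} {g u v : ℝ} (hg : 0 < g) (huv : u ≤ v)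
    (hsp : ∀ k ∈ S, ∀ l ∈ S, k ≤ l → g * ((l : ℝ) - k) ≤ a l - a k)
    (hS : ∀ k ∈ S, u ≤ a k ∧ a k ≤ v) : (S.card : ℝ) ≤ (v - u) / g + 1 := by
  rcases S.eq_empty_or_nonempty with rfl | hne
  · have : 0 ≤ (v - u) / g := div_nonneg (by linarith) hg.le
    simp; linarith
  set m := S.min' hne
  set M := S.max' hne
  have hmM : m ≤ M := S.min'_le_max' hne
  have h1 := hsp m (S.min'_mem hne) M (S.max'_mem hne) hmM
  have h2 := hS m (S.min'_mem hne)
  have h3 := hS M (S.max'_mem hne)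
  have h4 : S.card ≤ M + 1 - m := by
    rw [← Nat.card_Icc]
    exact Finset.card_le_card fun k hk => mem_Icc.2 ⟨S.min'_le k hk, S.le_max' k hk⟩
  have h5 : (S.card : ℝ) + m ≤ M + 1 := by exact_mod_cast (by omega : S.card + m ≤ M + 1)
  have h6 : (M : ℝ) - m ≤ (v - u) / g := by
    rw [le_div_iff₀ hg]; linarith
  linarith

lemma card_le_of_fibers {α β : Type*} [DecidableEq β] (S : Finset α) (t : Finset β) (f : α → β)
    (hf : ∀ k ∈ S, f k ∈ t) {C : ℝ} (hC : ∀ d ∈ t, ((S.filter fun k => f k = d).card : ℝ) ≤ C) :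
    (S.card : ℝ) ≤ t.card * C := by
  rw [Finset.card_eq_sum_card_fiberwise hf, Nat.cast_sum]
  exact (Finset.sum_le_card_nsmul _ _ C hC).trans (by simp)

/-- The predicate that `ξ` has a rational approximation of small denominator. -/
def NearSmallRat (K B : ℕ) (ξ : ℝ) : Prop :=
  ∃ r : ℚ, |ξ - r| ≤ 1 / ((K + 1) * r.den) ∧ r.den < B

lemma card_nearSmallRat_le {S : Finset ℕ} {a : ℕ → ℝ} {g : ℝ} (hg : 0 < g) {K : ℕ}
    (hK : 1 ≤ K) (B : ℕ) {Q : ℕ} (hQ : 1 ≤ Q)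
    (hsp : ∀ k ∈ S, ∀ l ∈ S, k ≤ l → g * ((l : ℝ) - k) ≤ a l - a k)
    (h0 : ∀ k ∈ S, 0 ≤ a k) (h1 : ∀ k ∈ S, a k ≤ Q) (hbad : ∀ k ∈ S, NearSmallRat K B (a k / Q)) :
    (S.card : ℝ) ≤ B ^ 2 * (2 * Q / (K * g) + 1) := by
  have hQ0 : (0 : ℝ) < Q := by exact_mod_cast hQ
  have hK0 : (0 : ℝ) < K := by exact_mod_cast hK
  choose! r hr hrB using hbad
  have hcard : ((range B ×ˢ range B).card : ℝ) = B ^ 2 := by simp [sq]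
  rw [← hcard]
  have key : ∀ k ∈ S, (r k : ℝ) * (r k).den = (r k).num := fun k _ => by
    exact_mod_cast Rat.mul_den_eq_num (r k)
  refine card_le_of_fibers S _ (fun k => ((r k).den, (r k).num.toNat)) (fun k hk => ?_) ?_
  · have hd : (0 : ℝ) < (r k).den := by exact_mod_cast (r k).den_pos
    have h := abs_le.1 (hr k hk)
    have e : 1 / (((K : ℝ) + 1) * (r k).den) * (r k).den < 1 := by
      rw [div_mul_eq_mul_div, one_mul, div_lt_one (by positivity)]
      nlinarith
    have u1 : a k / Q ≤ 1 := (div_le_one hQ0).2 (h1 k hk)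
    have n1 : ((r k).num : ℝ) < (r k).den + 1 := by
      rw [← key k hk]; nlinarith [h.1]
    have n3 : (r k).num < (r k).den + 1 := by exact_mod_cast n1
    have := hrB k hk
    simp only [mem_product, mem_range]
    omega
  · rintro ⟨b, p⟩ -
    rcases (S.filter fun k => ((r k).den, (r k).num.toNat) = (b, p)).eq_empty_or_nonempty with
      h | ⟨k₀, hk₀⟩
    · rw [h]; simp; positivity
    have hnonneg : ∀ k ∈ S, 0 ≤ (r k).num := by
      intro k hk
      have hd : (0 : ℝ) < (r k).den := by exact_mod_cast (r k).den_pos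
      have h := abs_le.1 (hr k hk)
      have e : 1 / (((K : ℝ) + 1) * (r k).den) * (r k).den < 1 := by
        rw [div_mul_eq_mul_div, one_mul, div_lt_one (by positivity)]
        nlinarith
      have u0 : 0 ≤ a k / Q := div_nonneg (h0 k hk) hQ0.le
      have n2 : (-1 : ℝ) < (r k).num := by
        rw [← key k hk]; nlinarith [h.2]
      have : (-1 : ℤ) < (r k).num := by exact_mod_cast n2
      omega
    set c := (Q : ℝ) * r k₀ with hc
    have hfin := card_le_of_spaced (S := S.filter fun k => ((r k).den, (r k).num.toNat) = (b, p))
      (a := a) hg (u := c - Q / K) (v := c + Q / K) (by have : 0 ≤ (Q : ℝ) / K := by positivity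
                                                        linarith)
      (fun k hk l hl => hsp k (mem_filter.1 hk).1 l (mem_filter.1 hl).1) ?_
    · refine hfin.trans (le_of_eq ?_)
      field_simp; ring
    intro k hk
    rw [mem_filter] at hk hk₀
    have e1 := hk.2.trans hk₀.2.symm
    rw [Prod.mk.injEq] at e1
    have e2 : r k = r k₀ := by
      refine Rat.ext ?_ e1.1
      have := hnonneg k hk.1
      have := hnonneg k₀ hk₀.1
      omega
    have hd : (1 : ℝ) ≤ (r k).den := by exact_mod_cast (r k).den_pos
    have h : |a k / Q - r k| ≤ 1 / K := by
      refine (hr k hk.1).trans ?_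
      gcongr
      nlinarith
    have h' : |a k - c| ≤ Q / K := by
      have : a k - c = Q * (a k / Q - r k) := by rw [hc, ← e2]; field_simp
      rw [this, abs_mul, abs_of_pos hQ0]
      calc _ ≤ (Q : ℝ) * (1 / K) := by gcongr
        _ = _ := by ring
    have := abs_le.1 h'
    constructor <;> linarith

lemma sum_comp_floor_le {S : Finset ℕ} {a : ℕ → ℝ} {g : ℝ} (hg : 0 < g) {Q : ℕ} [NeZero Q]
    (hsp : ∀ k ∈ S, ∀ l ∈ S, k ≤ l → g * ((l : ℝ) - k) ≤ a l - a k)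
    (h0 : ∀ k ∈ S, 0 ≤ a k) {j : ℕ} (hj : 1 ≤ j) {i : ℕ} (hi : i ≤ 1)
    (hQ : ∀ k ∈ S, j * a k + 1 < Q) (h : ZMod Q → ℝ) (hh : ∀ d, 0 ≤ h d) :
    ∑ k ∈ S, h (⌊j * a k⌋₊ + i : ℕ) ≤ (1 / g + 1) * ∑ d, h d := by
  have hj1 : (1 : ℝ) ≤ j := by exact_mod_cast hj
  rw [← Finset.sum_fiberwise_of_maps_to (s := S) (t := univ)
    (g := fun k => ((⌊j * a k⌋₊ + i : ℕ) : ZMod Q)) (fun _ _ => mem_univ _), Finset.mul_sum]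
  refine Finset.sum_le_sum fun d _ => ?_
  rw [Finset.sum_congr rfl (g := fun _ => h d) fun k hk => by rw [(mem_filter.1 hk).2],
    sum_const, nsmul_eq_mul]
  refine mul_le_mul_of_nonneg_right ?_ (hh d)
  have hfin := card_le_of_spaced (a := fun k => j * a k) (g := g)
    (S := S.filter fun k => ((⌊j * a k⌋₊ + i : ℕ) : ZMod Q) = d)
    (u := (d.val : ℝ) - i) (v := d.val - i + 1) hg (by linarith) ?_ ?_
  · have e : (d.val : ℝ) - i + 1 - (d.val - i) = 1 := by ring
    rwa [e] at hfin
  · intro k hk l hl hkl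
    have := hsp k (mem_filter.1 hk).1 l (mem_filter.1 hl).1 hkl
    have hkl' : (k : ℝ) ≤ l := by exact_mod_cast hkl
    have h2 : 0 ≤ g * ((l : ℝ) - k) := mul_nonneg hg.le (by linarith)
    nlinarith
  · intro k hk
    rw [mem_filter] at hk
    have hpos : 0 ≤ j * a k := mul_nonneg (by linarith) (h0 k hk.1)
    have f1 := Nat.floor_le hpos
    have f2 := Nat.lt_floor_add_one (j * a k)
    have hlt : ⌊j * a k⌋₊ + i < Q := by
      have : ((⌊j * a k⌋₊ + 1 : ℕ) : ℝ) < Q := by push_cast; linarith [hQ k hk.1]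
      have : ⌊j * a k⌋₊ + 1 < Q := by exact_mod_cast this
      omega
    have hv : d.val = ⌊j * a k⌋₊ + i := by
      rw [← hk.2, ZMod.val_natCast_of_lt hlt]
    rw [hv]; push_cast
    constructor <;> linarith

lemma sum_slopeCorr_le {S : Finset ℕ} {a : ℕ → ℝ} {g : ℝ} (hg : 0 < g) {Q₁ Q₂ : ℕ} [NeZero Q₁]
    [NeZero Q₂] [NeZero (Q₁ * Q₂)] (hco : Nat.Coprime Q₁ Q₂)
    (hsp : ∀ k ∈ S, ∀ l ∈ S, k ≤ l → g * ((l : ℝ) - k) ≤ a l - a k)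
    (h0 : ∀ k ∈ S, 0 ≤ a k) {j : ℕ} (hj : 1 ≤ j)
    (hQ : ∀ k ∈ S, j * a k + 1 < Q₁) (Φ₁ : ZMod Q₁ → ℂ) (Φ₂ : ZMod Q₂ → ℂ)
    (h₂ : ∀ z, ‖Φ₂ z‖ ≤ 1) {R : ℝ} (hR : ∑ d, ‖corr Φ₁ d‖ ≤ R * Q₁) :
    ∑ k ∈ S, slopeCorr (fun z : ZMod (Q₁ * Q₂) => Φ₁ z.cast * Φ₂ z.cast) (a k) j
      ≤ 2 * (1 / g + 1) * R := by
  have hQ1 : (0 : ℝ) < Q₁ := by exact_mod_cast Nat.pos_of_ne_zero (NeZero.ne Q₁)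
  have hQ2 : (0 : ℝ) < Q₂ := by exact_mod_cast Nat.pos_of_ne_zero (NeZero.ne Q₂)
  have hterm : ∀ k, slopeCorr (fun z : ZMod (Q₁ * Q₂) => Φ₁ z.cast * Φ₂ z.cast) (a k) j
      ≤ (‖corr Φ₁ (⌊j * a k⌋₊ + 0 : ℕ)‖ + ‖corr Φ₁ (⌊j * a k⌋₊ + 1 : ℕ)‖) / Q₁ := by
    intro k
    have e1 := norm_corr_mul_le hco Φ₁ Φ₂ h₂ ⌊j * a k⌋₊
    have e2 := norm_corr_mul_le hco Φ₁ Φ₂ h₂ (⌊j * a k⌋₊ + 1)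
    unfold slopeCorr
    rw [div_le_div_iff₀ (by push_cast; positivity) hQ1, add_zero]
    push_cast at e1 e2 ⊢
    nlinarith
  refine (Finset.sum_le_sum fun k _ => hterm k).trans ?_
  rw [← Finset.sum_div, Finset.sum_add_distrib, div_le_iff₀ hQ1]
  have b0 := sum_comp_floor_le hg hsp h0 hj (i := 0) (by omega) hQ (fun d => ‖corr Φ₁ d‖)
    fun _ => norm_nonneg _
  have b1 := sum_comp_floor_le hg hsp h0 hj (i := 1) le_rfl hQ (fun d => ‖corr Φ₁ d‖)
    fun _ => norm_nonneg _
  have hg' : 0 ≤ 1 / g + 1 := by positivity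
  have := mul_le_mul_of_nonneg_left hR hg'
  linarith

/-- Lower bound for the increments of `N ↦ c * N ^ (c - 1)`. -/
lemma slope_spacing {c : ℝ} (hc : 1 < c) (hc' : c < 2) {N N' x : ℝ} (hN : 1 ≤ N) (hNN : N ≤ N')
    (hx : N' ≤ x) :
    (c - 1) * x ^ (c - 2) * (N' - N) ≤ c * N' ^ (c - 1) - c * N ^ (c - 1) := by
  have hN'0 : 0 < N' := by linarith
  have e1 : N ^ (c - 1) = N' ^ (c - 1) * (1 + -((N' - N) / N')) ^ (c - 1) := by
    rw [← Real.mul_rpow hN'0.le]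
    · congr 1; field_simp; ring
    · have : 1 + -((N' - N) / N') = N / N' := by field_simp; ring
      rw [this]; positivity
  have e3 : N' ^ (c - 1) = N' ^ (c - 2) * N' := by
    rw [← Real.rpow_add_one hN'0.ne']; congr 1; ring
  have h := rpow_one_add_le_one_add_mul_self (s := -((N' - N) / N'))
    (by rw [neg_le_neg_iff, div_le_one hN'0]; linarith) (p := c - 1) (by linarith) (by linarith)
  have h2 : N ^ (c - 1) ≤ N' ^ (c - 1) - (c - 1) * N' ^ (c - 2) * (N' - N) := by
    rw [e1]
    calc _ ≤ N' ^ (c - 1) * (1 + (c - 1) * -((N' - N) / N')) := by gcongr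
      _ = _ := by
        have : N' ^ (c - 1) * (1 + (c - 1) * -((N' - N) / N'))
          = N' ^ (c - 1) - (c - 1) * (N' ^ (c - 1) / N') * (N' - N) := by field_simp; ring
        rw [this]; congr 3; rw [e3]; field_simp
  have h3 : x ^ (c - 2) ≤ N' ^ (c - 2) := Real.rpow_le_rpow_of_nonpos hN'0 hx (by linarith)
  have hx0 : 0 < x := by linarith
  have h4 : (c - 1) * x ^ (c - 2) * (N' - N) ≤ (c - 1) * N' ^ (c - 2) * (N' - N) := by
    have : 0 ≤ c - 1 := by linarith
    have : 0 ≤ N' - N := by linarith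
    gcongr
  have h5 : 0 ≤ (c - 1) * N' ^ (c - 2) * (N' - N) :=
    mul_nonneg (mul_nonneg (by linarith) (by positivity)) (by linarith)
  nlinarith

lemma exists_coprime_approx {K B : ℕ} (hK : 1 ≤ K) {ξ : ℝ} (h : ¬ NearSmallRat K B ξ) :
    ∃ (b : ℕ) (p : ℤ), 1 ≤ b ∧ B ≤ b ∧ b ≤ K ∧ IsCoprime p (b : ℤ) ∧
      |ξ - p / b| ≤ 1 / (b : ℝ) ^ 2 := by
  obtain ⟨r, hr, hrK⟩ := Real.exists_rat_abs_sub_le_and_den_le ξ (n := K) hK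
  refine ⟨r.den, r.num, r.den_pos, ?_, hrK, ?_, ?_⟩
  · by_contra hB
    exact h ⟨r, hr, by omega⟩
  · rw [Int.isCoprime_iff_gcd_eq_one]
    exact r.reduced
  · have e : ((r.num : ℝ) / (r.den : ℝ)) = (r : ℝ) := (Rat.cast_def r).symm
    rw [e]
    refine hr.trans ?_
    have h1 : (1 : ℝ) ≤ r.den := by exact_mod_cast r.den_pos
    have h2 : (r.den : ℝ) ≤ K := by exact_mod_cast hrK
    gcongr
    nlinarith

/-- The combined error of the terms not involving correlations, for one segment. -/
noncomputable def segmentError (c x y : ℝ) (Q₁ Q₂ H K B T : ℕ) : ℝ :=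
  2 * T ^ 2 + T ^ 2 * (2 * x ^ (c - 1) * (H + T ^ 2) / Q₁ + 1)
    + T ^ 2 * (2 * x ^ (c - 1) * (H + T ^ 2) / Q₂ + 1) + H / T
    + (T + 2) * (12 * (Q₁ * Q₂ : ℕ) * H / B + 2 * K) + 2 * H * (y ^ (c - 2) * H ^ 2)

lemma norm_sum_good_segment_le {Q₁ Q₂ : ℕ} [NeZero (Q₁ * Q₂)] {c : ℝ} (hc : 1 < c)
    (hc' : c < 18 / 17) {N x y : ℝ} (hy : 1 ≤ y) (hyN : y ≤ N) (hNx : N ≤ x)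
    (hQ₁ : 1 ≤ Q₁) (hQ₂ : 1 ≤ Q₂) {K B : ℕ} (hK : 1 ≤ K) (hB : 1 ≤ B)
    (hgood : ¬ NearSmallRat K B (c * N ^ (c - 1) / (Q₁ * Q₂ : ℕ)))
    (Φ : ZMod (Q₁ * Q₂) → ℂ) (hΦ : ∀ z, ‖Φ z‖ ≤ 1) (e₁ e₂ : ℕ → ℂ) (he₁ : ∀ n, ‖e₁ n‖ ≤ 1)
    (he₂ : ∀ n, ‖e₂ n‖ ≤ 1) (f : ℕ → ℂ) (hf : ∀ n : ℕ, f n = e₁ (n / Q₁) * e₂ (n / Q₂) * Φ n)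
    (H : ℕ) {T : ℕ} (hT : 1 ≤ T) (hη : y ^ (c - 2) * H ^ 2 ≤ 1) :
    ‖∑ n ∈ range H, f ⌊(N + n) ^ c⌋₊‖ ≤ segmentError c x y Q₁ Q₂ H K B T
      + H / T ^ 3 * ∑ z ∈ (range (T ^ 2)).offDiag,
          slopeCorr Φ (c * N ^ (c - 1)) ((z.1 - z.2) + (z.2 - z.1)) := by
  obtain ⟨b, p, hb, hBb, hbK, hp, ha⟩ := exists_coprime_approx hK hgood
  have hN : 1 ≤ N := hy.trans hyN
  have hyc : N ^ (c - 2) ≤ y ^ (c - 2) :=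
    Real.rpow_le_rpow_of_nonpos (by linarith) hyN (by linarith)
  have hη' : N ^ (c - 2) * (H : ℝ) ^ 2 ≤ y ^ (c - 2) * H ^ 2 := by gcongr
  refine (norm_sum_segment_le hc hc' hN hQ₁ hQ₂ hb hp ha Φ hΦ e₁ e₂ he₁ he₂ f hf H hT
    (hη'.trans hη)).trans ?_
  have hcN : c * N ^ (c - 1) ≤ 2 * x ^ (c - 1) := by
    have : 0 ≤ c - 1 := by linarith
    have : c ≤ 2 := by linarith
    gcongr
  have hB0 : (0 : ℝ) < B := by exact_mod_cast hB
  have hBb' : (B : ℝ) ≤ b := by exact_mod_cast hBb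
  have hbK' : (b : ℝ) ≤ K := by exact_mod_cast hbK
  unfold segmentError
  gcongr

lemma norm_sum_le_parameters {Q₁ Q₂ : ℕ} [NeZero Q₁] [NeZero Q₂] (hco : Nat.Coprime Q₁ Q₂)
    {c : ℝ} (hc : 1 < c) (hc' : c < 18 / 17) {x y : ℝ} (hx : 1 ≤ x) (hy : 1 ≤ y)
    {K B T H : ℕ} (hK : 1 ≤ K) (hB : 1 ≤ B) (hT : 1 ≤ T) (hH : 1 ≤ H)
    (Φ₁ : ZMod Q₁ → ℂ) (h₁ : ∀ z, ‖Φ₁ z‖ ≤ 1) (Φ₂ : ZMod Q₂ → ℂ) (h₂ : ∀ z, ‖Φ₂ z‖ ≤ 1)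
    (e₁ e₂ : ℕ → ℂ) (he₁ : ∀ n, ‖e₁ n‖ ≤ 1) (he₂ : ∀ n, ‖e₂ n‖ ≤ 1) (f : ℕ → ℂ)
    (hf : ∀ n : ℕ, f n = e₁ (n / Q₁) * e₂ (n / Q₂) * (Φ₁ n * Φ₂ n))
    {R : ℝ} (hR0 : 0 ≤ R) (hR : ∑ d, ‖corr Φ₁ d‖ ≤ R * Q₁)
    (hη : y ^ (c - 2) * H ^ 2 ≤ 1) (hQ : T ^ 2 * (2 * x ^ (c - 1)) + 1 < Q₁) :
    ‖∑ n ∈ Icc 1 ⌊x⌋₊, f ⌊(n : ℝ) ^ c⌋₊‖ ≤ 2 * H + y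
      + H * (B ^ 2 * (2 * (Q₁ * Q₂ : ℕ) / (K * ((c - 1) * x ^ (c - 2) * H)) + 1))
      + x / H * segmentError c x y Q₁ Q₂ H K B T
      + T * H * (2 * (1 / ((c - 1) * x ^ (c - 2) * H) + 1) * R) := by
  classical
  have hQ₁ : 1 ≤ Q₁ := Nat.pos_of_ne_zero (NeZero.ne Q₁)
  have hQ₂ : 1 ≤ Q₂ := Nat.pos_of_ne_zero (NeZero.ne Q₂)
  have : NeZero (Q₁ * Q₂) := ⟨(Nat.mul_pos hQ₁ hQ₂).ne'⟩
  set Φ : ZMod (Q₁ * Q₂) → ℂ := fun z => Φ₁ z.cast * Φ₂ z.cast with hΦ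
  have hΦ1 : ∀ z, ‖Φ z‖ ≤ 1 := fun z => by
    rw [hΦ, norm_mul]; exact mul_le_one₀ (h₁ _) (norm_nonneg _) (h₂ _)
  have hf' : ∀ n : ℕ, f n = e₁ (n / Q₁) * e₂ (n / Q₂) * Φ n := fun n => by
    rw [hf, hΦ]
    simp only
    rw [ZMod.cast_natCast (dvd_mul_right _ _), ZMod.cast_natCast (dvd_mul_left _ _)]
  have hf1 : ∀ n, ‖f n‖ ≤ 1 := fun n => by
    rw [hf', norm_mul, norm_mul]
    exact mul_le_one₀ (mul_le_one₀ (he₁ _) (norm_nonneg _) (he₂ _)) (norm_nonneg _) (hΦ1 _)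
  have hH0 : (0 : ℝ) < H := by exact_mod_cast hH
  have hT0 : (0 : ℝ) < T := by exact_mod_cast hT
  have hT1 : (1 : ℝ) ≤ T := by exact_mod_cast hT
  have hx0 : 0 < x := by linarith
  set g := (c - 1) * x ^ (c - 2) * (H : ℝ) with hg
  have hg0 : 0 < g := by
    have : 0 < c - 1 := by linarith
    positivity
  set E := segmentError c x y Q₁ Q₂ H K B T with hE
  have hE0 : 0 ≤ E := by
    rw [hE]; unfold segmentError; positivity
  set M := ⌊x⌋₊ / H with hM
  set N : ℕ → ℝ := fun k => 1 + k * H with hN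
  set a : ℕ → ℝ := fun k => c * N k ^ (c - 1) with ha
  have hMH : M * H ≤ ⌊x⌋₊ := Nat.div_mul_le_self _ _
  have hfx : (⌊x⌋₊ : ℝ) ≤ x := Nat.floor_le hx0.le
  have hMx : (M : ℝ) ≤ x / H := by
    rw [le_div_iff₀ hH0]
    refine le_trans ?_ hfx
    exact_mod_cast hMH
  have hN1 : ∀ k, 1 ≤ N k := fun k => by
    have : (0 : ℝ) ≤ k * H := by positivity
    simp only [hN]; linarith
  have hNx : ∀ k ∈ range M, N k ≤ x := by
    intro k hk
    have h1 : k + 1 ≤ M := mem_range.1 hk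
    have h2 : 1 + k * H ≤ ⌊x⌋₊ := by nlinarith
    refine le_trans ?_ hfx
    simp only [hN]
    exact_mod_cast h2
  have hNmono : ∀ k l : ℕ, k ≤ l → N k ≤ N l := fun k l h => by
    have : (k : ℝ) ≤ l := by exact_mod_cast h
    simp only [hN]; gcongr
  have hsp : ∀ k ∈ range M, ∀ l ∈ range M, k ≤ l → g * ((l : ℝ) - k) ≤ a l - a k := by
    intro k _ l hl hkl
    refine le_trans (le_of_eq ?_) (slope_spacing hc (by linarith) (hN1 k) (hNmono k l hkl) (hNx l hl))
    simp only [hN, hg]; ring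
  have ha0 : ∀ k, 0 ≤ a k := fun k => by
    have := hN1 k
    simp only [ha]; positivity
  have hax : ∀ k ∈ range M, a k ≤ 2 * x ^ (c - 1) := by
    intro k hk
    have h0 : 0 ≤ c - 1 := by linarith
    have h1 : c ≤ 2 := by linarith
    have h2 := hN1 k
    have h3 := hNx k hk
    simp only [ha]
    gcongr
  have hT2 : (1 : ℝ) ≤ (T : ℝ) ^ 2 := one_le_pow₀ hT1
  have hxc : 0 < x ^ (c - 1) := by positivity
  have haQ : ∀ k ∈ range M, a k ≤ (Q₁ * Q₂ : ℕ) := by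
    intro k hk
    have h1 := hax k hk
    have h2 : (1 : ℝ) ≤ Q₂ := by exact_mod_cast hQ₂
    push_cast
    nlinarith
  set low := (range M).filter fun k => N k < y with hlow
  set bad := (range M).filter fun k => NearSmallRat K B (a k / (Q₁ * Q₂ : ℕ)) with hbad
  set good := (range M).filter fun k => ¬ (N k < y) ∧
    ¬ NearSmallRat K B (a k / (Q₁ * Q₂ : ℕ)) with hgood
  set Γ : ℕ → ℝ := fun k => ∑ z ∈ (range (T ^ 2)).offDiag,
    slopeCorr Φ (a k) ((z.1 - z.2) + (z.2 - z.1)) with hΓ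
  have hΓ0 : ∀ k, 0 ≤ Γ k := fun k => Finset.sum_nonneg fun _ _ => slopeCorr_nonneg _ _ _
  have hlowcard : (low.card : ℝ) * H ≤ y + H := by
    have h1 : low.card ≤ ⌊y / H⌋₊ + 1 := by
      rw [← card_range (⌊y / H⌋₊ + 1)]
      refine card_le_card fun k hk => ?_
      rw [hlow, mem_filter] at hk
      rw [mem_range, Nat.lt_add_one_iff]
      refine Nat.le_floor ?_
      rw [le_div_iff₀ hH0]
      have := hk.2
      simp only [hN] at this
      linarith
    have h2 : (low.card : ℝ) ≤ ⌊y / H⌋₊ + 1 := by exact_mod_cast h1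
    have h3 := Nat.floor_le (show 0 ≤ y / H by positivity)
    have h4 : (low.card : ℝ) ≤ y / H + 1 := by linarith
    calc _ ≤ (y / H + 1) * H := by gcongr
      _ = _ := by field_simp
  have hbadcard : (bad.card : ℝ) ≤ B ^ 2 * (2 * (Q₁ * Q₂ : ℕ) / (K * g) + 1) :=
    card_nearSmallRat_le hg0 hK B (Nat.mul_pos hQ₁ hQ₂)
      (fun k hk l hl => hsp k (mem_filter.1 hk).1 l (mem_filter.1 hl).1) (fun k _ => ha0 k)
      (fun k hk => haQ k (mem_filter.1 hk).1) (fun k hk => (mem_filter.1 hk).2)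
  have hgoodΓ : ∑ k ∈ good, Γ k ≤ T ^ 4 * (2 * (1 / g + 1) * R) := by
    simp only [hΓ]
    rw [Finset.sum_comm]
    have hC0 : 0 ≤ 2 * (1 / g + 1) * R := by positivity
    refine (Finset.sum_le_card_nsmul _ _ (2 * (1 / g + 1) * R) fun z hz => ?_).trans ?_
    · rw [mem_offDiag, mem_range, mem_range] at hz
      refine sum_slopeCorr_le hg0 hco
        (fun k hk l hl => hsp k (mem_filter.1 hk).1 l (mem_filter.1 hl).1) (fun k _ => ha0 k)
        (by omega) (fun k hk => ?_) Φ₁ Φ₂ h₂ hR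
      have h1 : ((z.1 - z.2 + (z.2 - z.1) : ℕ) : ℝ) ≤ (T : ℝ) ^ 2 := by
        exact_mod_cast (by omega : z.1 - z.2 + (z.2 - z.1) ≤ T ^ 2)
      have h2 := mul_le_mul h1 (hax k (mem_filter.1 hk).1) (ha0 k) (by positivity)
      linarith
    · rw [nsmul_eq_mul]
      gcongr
      rw [offDiag_card, card_range]
      have : T ^ 2 * T ^ 2 - T ^ 2 ≤ T ^ 4 := (Nat.sub_le _ _).trans (le_of_eq (by ring))
      exact_mod_cast this
  have hseg : ∀ k ∈ range M, ‖∑ i ∈ range H, f ⌊(N k + i) ^ c⌋₊‖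
      ≤ (if N k < y then (H : ℝ) else 0)
        + (if NearSmallRat K B (a k / (Q₁ * Q₂ : ℕ)) then (H : ℝ) else 0) + E
        + (if ¬ (N k < y) ∧ ¬ NearSmallRat K B (a k / (Q₁ * Q₂ : ℕ)) then H / T ^ 3 * Γ k else 0) := by
    intro k hk
    have htriv : ‖∑ i ∈ range H, f ⌊(N k + i) ^ c⌋₊‖ ≤ H :=
      (norm_sum_le_of_le _ fun i _ => hf1 _).trans (by simp)
    by_cases h1 : N k < y
    · rw [if_pos h1, if_neg (not_and.2 fun h => absurd h1 h)]
      split_ifs <;> linarith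
    by_cases h2 : NearSmallRat K B (a k / (Q₁ * Q₂ : ℕ))
    · rw [if_neg h1, if_pos h2, if_neg (not_and_not_right.2 fun _ => h2)]
      linarith
    rw [if_neg h1, if_neg h2, if_pos ⟨h1, h2⟩, zero_add, zero_add]
    exact norm_sum_good_segment_le hc hc' hy (not_lt.1 h1) (hNx k hk) hQ₁ hQ₂ hK hB h2 Φ hΦ1
      e₁ e₂ he₁ he₂ f hf' H hT hη
  have hsum := Finset.sum_le_sum hseg
  rw [Finset.sum_add_distrib, Finset.sum_add_distrib, Finset.sum_add_distrib,
    ← Finset.sum_filter, ← Finset.sum_filter, ← Finset.sum_filter, ← hlow, ← hbad, ← hgood,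
    ← Finset.mul_sum, sum_const, sum_const, sum_const, card_range, nsmul_eq_mul, nsmul_eq_mul,
    nsmul_eq_mul] at hsum
  have hblocks := norm_sum_le_sum_blocks (fun j => f ⌊(1 + (j : ℝ)) ^ c⌋₊) (fun _ => hf1 _) hH ⌊x⌋₊
  have hre : ∑ n ∈ Icc 1 ⌊x⌋₊, f ⌊(n : ℝ) ^ c⌋₊ = ∑ j ∈ range ⌊x⌋₊, f ⌊(1 + (j : ℝ)) ^ c⌋₊ := by
    rw [Finset.range_eq_Ico, ← Finset.Ico_add_one_right_eq_Icc,
      Finset.sum_Ico_eq_sum_range, Finset.range_eq_Ico]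
    refine Finset.sum_congr (by simp) fun j _ => by push_cast; rfl
  have hblk : ∀ k, ∑ i ∈ range H, f ⌊(1 + ((k * H + i : ℕ) : ℝ)) ^ c⌋₊
      = ∑ i ∈ range H, f ⌊(N k + i) ^ c⌋₊ := fun k => by
    refine Finset.sum_congr rfl fun i _ => ?_
    simp only [hN]; push_cast; rw [add_assoc]
  simp only [hblk] at hblocks
  rw [hre]
  have hA : (bad.card : ℝ) * H ≤ H * (B ^ 2 * (2 * (Q₁ * Q₂ : ℕ) / (K * g) + 1)) := by
    rw [mul_comm]; gcongr
  have hB' : (M : ℝ) * E ≤ x / H * E := by gcongr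
  have hC : (H : ℝ) / T ^ 3 * ∑ k ∈ good, Γ k ≤ T * H * (2 * (1 / g + 1) * R) := by
    calc _ ≤ (H : ℝ) / T ^ 3 * (T ^ 4 * (2 * (1 / g + 1) * R)) := by gcongr
      _ = _ := by field_simp
  linarith

section Parameters

variable {w z x : ℝ}

lemma monomial_le (hw : 1 ≤ w) (hz : 1 ≤ z) (h : z ^ 11 * w ^ 70 ≤ x) {i j : ℕ} (hi : i ≤ 11)
    (hj : j ≤ 69) : z ^ i * w ^ j ≤ x / w := by
  rw [le_div_iff₀ (by linarith)]
  calc z ^ i * w ^ j * w = z ^ i * w ^ (j + 1) := by ring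
    _ ≤ z ^ 11 * w ^ 70 := by gcongr; omega
    _ ≤ x := h

lemma bad_slopes_term_le {κ q Q H K B : ℝ} (hκ : 0 < κ) (hw : 1 ≤ w) (hz : 1 ≤ z) (hx : 0 < x)
    (h : z ^ 11 * w ^ 70 ≤ x) (hq : 0 ≤ q) (hQ0 : 0 ≤ Q) (hB0 : 0 ≤ B) (hQ : Q ≤ q * (z ^ 2 * w ^ 8))
    (hH0 : 0 < H) (hH' : H ≤ 2 * (z ^ 5 * w ^ 32)) (hK : z ^ 5 * w ^ 30 ≤ K)
    (hB : B ≤ 2 * (z ^ 2 * w ^ 10)) :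
    H * (B ^ 2 * (2 * Q / (K * (κ * (z / x) * H)) + 1)) ≤ (8 * q / κ + 8) * (x / w) := by
  have hw0 : 0 < w := by linarith
  have hz0 : 0 < z := by linarith
  have hK0 : 0 < K := lt_of_lt_of_le (by positivity) hK
  have e : H * (B ^ 2 * (2 * Q / (K * (κ * (z / x) * H)) + 1))
      = B ^ 2 * (2 * Q) * x / (K * κ * z) + H * B ^ 2 := by field_simp
  have h1 : B ^ 2 * (2 * Q) * x / (K * κ * z) ≤ 8 * q / κ * (x / w) := by
    calc _ ≤ (2 * (z ^ 2 * w ^ 10)) ^ 2 * (2 * (q * (z ^ 2 * w ^ 8))) * x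
          / (z ^ 5 * w ^ 30 * κ * z) := by gcongr
      _ = 8 * q / κ * (x / w) / w := by field_simp; ring
      _ ≤ _ := div_le_self (by positivity) hw
  have h2 : H * B ^ 2 ≤ 8 * (x / w) := by
    calc _ ≤ (2 * (z ^ 5 * w ^ 32)) * (2 * (z ^ 2 * w ^ 10)) ^ 2 := by gcongr
      _ = 8 * (z ^ 9 * w ^ 52) := by ring
      _ ≤ _ := by gcongr; exact monomial_le hw hz h (by norm_num) (by norm_num)
  rw [e]; linarith

lemma correlation_term_le {κ r H T R : ℝ} (hκ : 0 < κ) (hw : 1 ≤ w) (hz : 1 ≤ z) (hx : 0 < x)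
    (h : z ^ 11 * w ^ 70 ≤ x) (hr : 0 ≤ r) (hR0 : 0 ≤ R) (hR : R ≤ r * (z / w ^ 2))
    (hH0 : 0 < H) (hH' : H ≤ 2 * (z ^ 5 * w ^ 32)) (hT : T ≤ 2 * w) :
    T * H * (2 * (1 / (κ * (z / x) * H) + 1) * R) ≤ (4 * r / κ + 8 * r) * (x / w) := by
  have hw0 : 0 < w := by linarith
  have hz0 : 0 < z := by linarith
  have e : T * H * (2 * (1 / (κ * (z / x) * H) + 1) * R)
      = 2 * T * (x / (κ * z)) * R + 2 * T * H * R := by field_simp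
  have h1 : 2 * T * (x / (κ * z)) * R ≤ 4 * r / κ * (x / w) := by
    calc _ ≤ 2 * (2 * w) * (x / (κ * z)) * (r * (z / w ^ 2)) := by gcongr
      _ = 4 * r / κ * (x / w) := by field_simp; ring
  have h2 : 2 * T * H * R ≤ 8 * r * (x / w) := by
    calc _ ≤ 2 * (2 * w) * (2 * (z ^ 5 * w ^ 32)) * (r * (z / w ^ 2)) := by gcongr
      _ = 8 * r * (z ^ 6 * w ^ 31) := by field_simp; ring
      _ ≤ _ := by gcongr; exact monomial_le hw hz h (by norm_num) (by norm_num)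
  rw [e]; linarith

lemma segmentError_term_le {c q : ℝ} {Q₁ Q₂ H K B T : ℕ} (hw : 1 ≤ w) (hz : 1 ≤ z) (hx : 0 < x)
    (h : z ^ 11 * w ^ 70 ≤ x) (hzx : x ^ (c - 1) = z) (hyx : (x / w) ^ (c - 2) ≤ z * w / x)
    (hq : 0 ≤ q) (hQ : ((Q₁ * Q₂ : ℕ) : ℝ) ≤ q * (z ^ 2 * w ^ 8))
    (hQ₁ : z * w ^ 4 ≤ Q₁) (hQ₂ : z * w ^ 4 ≤ Q₂)
    (hH : z ^ 5 * w ^ 32 ≤ H) (hH' : H ≤ 2 * (z ^ 5 * w ^ 32)) (hK : K ≤ 2 * (z ^ 5 * w ^ 30))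
    (hB : z ^ 2 * w ^ 10 ≤ B) (hT : w ≤ T) (hT' : T ≤ 2 * w) :
    x / H * segmentError c x (x / w) Q₁ Q₂ H K B T ≤ (121 + 48 * q) * (x / w) := by
  have hw0 : 0 < w := by linarith
  have hz0 : 0 < z := by linarith
  have hT0 : (0 : ℝ) < T := lt_of_lt_of_le hw0 hT
  have hH0 : (0 : ℝ) < H := lt_of_lt_of_le (by positivity) hH
  have hB0 : (0 : ℝ) < B := lt_of_lt_of_le (by positivity) hB
  have hQ₁0 : (0 : ℝ) < Q₁ := lt_of_lt_of_le (by positivity) hQ₁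
  have hQ₂0 : (0 : ℝ) < Q₂ := lt_of_lt_of_le (by positivity) hQ₂
  have hTH : (T : ℝ) ^ 2 / H ≤ 4 / w := by
    calc _ ≤ (2 * w) ^ 2 / (1 ^ 5 * w ^ 3) := by
          have : (1 : ℝ) ^ 5 * w ^ 3 ≤ H := by
            refine le_trans ?_ hH
            gcongr; norm_num
          gcongr
      _ = 4 / w := by field_simp; ring
  have hTH' : (T : ℝ) ^ 2 / H ≤ 4 := hTH.trans (div_le_self (by norm_num) hw)
  have hquot : ∀ P : ℝ, z * w ^ 4 ≤ P → T ^ 2 * (2 * z * (1 + T ^ 2 / H) / P) ≤ 40 / w := by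
    intro P hP
    have hP0 : 0 < P := lt_of_lt_of_le (by positivity) hP
    calc _ ≤ (2 * w) ^ 2 * (2 * z * (1 + 4) / (z * w ^ 4)) := by gcongr
      _ = 40 / w / w := by field_simp; ring
      _ ≤ _ := div_le_self (by positivity) hw
  have hTinv : 1 / (T : ℝ) ≤ 1 / w := by gcongr
  have hT2 : (T : ℝ) + 2 ≤ 4 * w := by linarith
  have hQB : (T + 2) * (12 * (Q₁ * Q₂ : ℕ) / B) ≤ 48 * q / w := by
    calc _ ≤ 4 * w * (12 * (q * (z ^ 2 * w ^ 8)) / (z ^ 2 * w ^ 10)) := by gcongr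
      _ = _ := by field_simp; ring
  have hKH : (T + 2) * (2 * K / H) ≤ 16 / w := by
    calc _ ≤ 4 * w * (2 * (2 * (z ^ 5 * w ^ 30)) / (z ^ 5 * w ^ 32)) := by gcongr
      _ = _ := by field_simp; ring
  have hHy : 2 * ((x / w) ^ (c - 2) * H ^ 2) ≤ 8 / w := by
    calc _ ≤ 2 * (z * w / x * (2 * (z ^ 5 * w ^ 32)) ^ 2) := by gcongr
      _ = 8 / x * (z ^ 11 * w ^ 65) := by field_simp; ring
      _ ≤ 8 / x * (x / w) := by
        gcongr; exact monomial_le hw hz h (by norm_num) (by norm_num)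
      _ = _ := by field_simp
  have e : x / H * segmentError c x (x / w) Q₁ Q₂ H K B T = x * (2 * (T ^ 2 / H)
      + (T ^ 2 * (2 * z * (1 + T ^ 2 / H) / Q₁) + T ^ 2 / H)
      + (T ^ 2 * (2 * z * (1 + T ^ 2 / H) / Q₂) + T ^ 2 / H) + 1 / T
      + ((T + 2) * (12 * (Q₁ * Q₂ : ℕ) / B) + (T + 2) * (2 * K / H))
      + 2 * ((x / w) ^ (c - 2) * H ^ 2)) := by
    unfold segmentError
    rw [hzx]
    field_simp
  rw [e]
  calc _ ≤ x * (2 * (4 / w) + (40 / w + 4 / w) + (40 / w + 4 / w) + 1 / w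
        + (48 * q / w + 16 / w) + 8 / w) := by
        have := hquot _ hQ₁
        have := hquot _ hQ₂
        gcongr
    _ = _ := by field_simp; ring

end Parameters

lemma exists_nat_between {t : ℝ} (ht : 1 ≤ t) : ∃ n : ℕ, 1 ≤ n ∧ t ≤ n ∧ (n : ℝ) ≤ 2 * t := by
  refine ⟨⌈t⌉₊, Nat.one_le_ceil_iff.2 (by linarith), Nat.le_ceil t, ?_⟩
  linarith [Nat.ceil_lt_add_one (show 0 ≤ t by linarith)]

lemma exists_pow_between {q : ℕ} (hq : 2 ≤ q) {t : ℝ} (ht : 1 ≤ t) :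
    ∃ l : ℕ, t ≤ (q ^ l : ℕ) ∧ ((q ^ l : ℕ) : ℝ) ≤ q * t := by
  have hq1 : (1 : ℝ) < q := by exact_mod_cast hq
  obtain ⟨n, h1, h2⟩ := exists_nat_pow_near ht hq1
  refine ⟨n + 1, by push_cast; exact h2.le, ?_⟩
  push_cast
  rw [pow_succ']
  gcongr

set_option maxHeartbeats 1000000 in
/-- Power saving for the exponential sums attached to digit sums along `⌊n ^ c⌋`. -/
lemma exists_norm_sum_ex_digits_le {q₁ q₂ : ℕ} (hq₁ : 2 ≤ q₁) (hq₂ : 2 ≤ q₂)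
    (hco : Nat.Coprime q₁ q₂) {c : ℝ} (hc : 1 < c) (hc' : c < 18 / 17) {α₁ : ℝ}
    (hα : ¬ ∃ n : ℤ, ((q₁ : ℝ) - 1) * α₁ = n) (α₂ : ℝ) :
    ∃ ε : ℝ, 0 < ε ∧ ∃ C : ℝ, ∀ x : ℝ, 1 ≤ x →
      ‖∑ n ∈ Icc 1 ⌊x⌋₊, ex (α₁ * s q₁ ⌊(n : ℝ) ^ c⌋₊) * ex (α₂ * s q₂ ⌊(n : ℝ) ^ c⌋₊)‖
        ≤ C * x ^ (1 - ε) := by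
  obtain ⟨τ, hτ0, hτ1, hτ⟩ := exists_sum_norm_corr_digitFn hq₁ hα
  set κ := c - 1 with hκ
  have hκ0 : 0 < κ := by linarith
  have hκτ : 0 < κ * (1 - τ) := mul_pos hκ0 (by linarith)
  set ε := min (1 / 200) (κ * (1 - τ) / 6) with hε
  have hε0 : 0 < ε := lt_min (by norm_num) (by linarith)
  have hε1 : ε ≤ 1 / 200 := min_le_left _ _
  have hε2 : ε ≤ κ * (1 - τ) / 6 := min_le_right _ _
  have hq₁1 : (1 : ℝ) ≤ q₁ := by exact_mod_cast (by omega : 1 ≤ q₁)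
  have hq₂1 : (1 : ℝ) ≤ q₂ := by exact_mod_cast (by omega : 1 ≤ q₂)
  set q : ℝ := q₁ * q₂ with hqdef
  set r : ℝ := q₁ ^ 2 with hrdef
  have hq0 : 0 ≤ q := by positivity
  have hr0 : 0 ≤ r := by positivity
  refine ⟨ε, hε0, 5 + (8 * q / κ + 8) + (121 + 48 * q) + (4 * r / κ + 8 * r), fun x hx => ?_⟩
  have hx0 : 0 < x := by linarith
  set w := x ^ ε with hw
  set z := x ^ κ with hz
  have hw1 : 1 ≤ w := Real.one_le_rpow hx hε0.le
  have hz1 : 1 ≤ z := Real.one_le_rpow hx hκ0.le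
  have hw0 : 0 < w := by linarith
  have hz0 : 0 < z := by linarith
  have hxw : x ^ (1 - ε) = x / w := by rw [Real.rpow_sub hx0, Real.rpow_one]
  rw [hxw]
  by_cases hw4 : w < 4
  · refine (norm_sum_le_of_le _ (n := fun _ => (1 : ℝ)) fun n _ => ?_).trans ?_
    · rw [norm_mul, norm_ex, norm_ex, one_mul]
    · have h1 : (⌊x⌋₊ : ℝ) ≤ x := Nat.floor_le hx0.le
      have h2 : 0 ≤ 8 * q / κ := by positivity
      have h3 : 0 ≤ 4 * r / κ := by positivity
      have h4 : x = w * (x / w) := by field_simp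
      have h5 : 0 ≤ x / w := by positivity
      rw [sum_const, Nat.card_Icc, nsmul_eq_mul, mul_one, Nat.add_sub_cancel]
      refine h1.trans ?_
      conv_lhs => rw [h4]
      gcongr
      linarith
  push Not at hw4
  have hmon : z ^ 11 * w ^ 70 ≤ x := by
    rw [hz, hw, ← Real.rpow_mul_natCast hx0.le, ← Real.rpow_mul_natCast hx0.le,
      ← Real.rpow_add hx0]
    conv_rhs => rw [← Real.rpow_one x]
    refine Real.rpow_le_rpow_of_exponent_le hx ?_
    push_cast; linarith
  have hyx : (x / w) ^ (c - 2) ≤ z * w / x := by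
    have e1 : x ^ (c - 2) = z / x := by
      rw [hz, div_eq_mul_inv, ← Real.rpow_neg_one x, ← Real.rpow_add hx0]; congr 1; rw [hκ]; ring
    rw [Real.div_rpow hx0.le hw0.le, e1]
    have e2 : w⁻¹ ≤ w ^ (c - 2) := by
      rw [← Real.rpow_neg_one w]
      exact Real.rpow_le_rpow_of_exponent_le hw1 (by linarith)
    calc z / x / w ^ (c - 2) ≤ z / x / w⁻¹ := by gcongr
      _ = _ := by field_simp
  have hx2 : x ^ (c - 2) = z / x := by
    rw [hz, div_eq_mul_inv, ← Real.rpow_neg_one x, ← Real.rpow_add hx0]; congr 1; rw [hκ]; ring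
  have hy : 1 ≤ x / w := by
    simpa using monomial_le hw1 hz1 hmon (i := 0) (j := 0) (by norm_num) (by norm_num)
  have hpow : ∀ i j : ℕ, 1 ≤ z ^ i * w ^ j := fun i j =>
    one_le_mul_of_one_le_of_one_le (one_le_pow₀ hz1) (one_le_pow₀ hw1)
  obtain ⟨T, hT, hwT, hTw⟩ := exists_nat_between hw1
  obtain ⟨B, hB, hwB, hBw⟩ := exists_nat_between (hpow 2 10)
  obtain ⟨K, hK, hwK, hKw⟩ := exists_nat_between (hpow 5 30)
  obtain ⟨H, hH, hwH, hHw⟩ := exists_nat_between (hpow 5 32)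
  obtain ⟨l₁, hl₁, hl₁'⟩ := exists_pow_between hq₁ (by simpa using hpow 1 4 : 1 ≤ z * w ^ 4)
  obtain ⟨l₂, hl₂, hl₂'⟩ := exists_pow_between hq₂ (by simpa using hpow 1 4 : 1 ≤ z * w ^ 4)
  have hn₁ : NeZero (q₁ ^ l₁) := ⟨(Nat.pow_pos (by omega)).ne'⟩
  have hn₂ : NeZero (q₂ ^ l₂) := ⟨(Nat.pow_pos (by omega)).ne'⟩
  have hH0 : (0 : ℝ) < H := by exact_mod_cast hH
  set R : ℝ := q₁ * ((q₁ : ℝ) ^ l₁) ^ τ with hR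
  have hRle : R ≤ r * (z / w ^ 2) := by
    push_cast at hl₁'
    have e1 : (q₁ : ℝ) ^ τ ≤ q₁ := by
      conv_rhs => rw [← Real.rpow_one (q₁ : ℝ)]
      exact Real.rpow_le_rpow_of_exponent_le hq₁1 hτ1.le
    have e2 : (w ^ 4) ^ τ ≤ w ^ 4 := by
      conv_rhs => rw [← Real.rpow_one (w ^ 4)]
      exact Real.rpow_le_rpow_of_exponent_le (one_le_pow₀ hw1) hτ1.le
    have e3 : w ^ 6 ≤ z ^ (1 - τ) := by
      rw [hz, hw, ← Real.rpow_mul_natCast hx0.le, ← Real.rpow_mul hx0.le]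
      refine Real.rpow_le_rpow_of_exponent_le hx ?_
      push_cast; linarith
    have e4 : z ^ τ ≤ z / w ^ 6 := by
      rw [le_div_iff₀ (by positivity)]
      calc z ^ τ * w ^ 6 ≤ z ^ τ * z ^ (1 - τ) := by gcongr
        _ = z := by rw [← Real.rpow_add hz0]; simp
    calc R ≤ q₁ * (q₁ * (z * w ^ 4)) ^ τ := by rw [hR]; gcongr
      _ = q₁ * ((q₁ : ℝ) ^ τ * (z ^ τ * (w ^ 4) ^ τ)) := by
        rw [Real.mul_rpow (by positivity) (by positivity), Real.mul_rpow (by positivity) (by positivity)]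
      _ ≤ q₁ * (q₁ * (z / w ^ 6 * w ^ 4)) := by gcongr
      _ = _ := by rw [hrdef]; field_simp
  have hη : (x / w) ^ (c - 2) * (H : ℝ) ^ 2 ≤ 1 := by
    calc _ ≤ z * w / x * (2 * (z ^ 5 * w ^ 32)) ^ 2 := by gcongr
      _ = 4 / x * (z ^ 11 * w ^ 65) := by field_simp; ring
      _ ≤ 4 / x * (x / w) := by
        gcongr; exact monomial_le hw1 hz1 hmon (by norm_num) (by norm_num)
      _ = 4 / w := by field_simp
      _ ≤ 1 := by rw [div_le_one hw0]; exact hw4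
  have hQ : (T : ℝ) ^ 2 * (2 * x ^ (c - 1)) + 1 < (q₁ ^ l₁ : ℕ) := by
    refine lt_of_lt_of_le ?_ hl₁
    rw [← hκ, ← hz]
    have h1 : (T : ℝ) ^ 2 * (2 * z) ≤ (2 * w) ^ 2 * (2 * z) := by gcongr
    have h2 : 16 ≤ w ^ 2 := by nlinarith
    have h3 : 16 ≤ z * w ^ 2 := by nlinarith
    have h4 : z * w ^ 4 = (z * w ^ 2) * w ^ 2 := by ring
    nlinarith
  have hmain := norm_sum_le_parameters (hco.pow l₁ l₂) hc hc' hx hy hK hB hT hH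
    (digitFn q₁ α₁ (q₁ ^ l₁)) (fun z => (norm_digitFn _ _ _ z).le)
    (digitFn q₂ α₂ (q₂ ^ l₂)) (fun z => (norm_digitFn _ _ _ z).le)
    (fun n => ex (α₁ * s q₁ n)) (fun n => ex (α₂ * s q₂ n)) (fun n => (norm_ex _).le)
    (fun n => (norm_ex _).le) (fun n => ex (α₁ * s q₁ n) * ex (α₂ * s q₂ n))
    (fun n => by rw [ex_s_eq hq₁ α₁ l₁ n, ex_s_eq hq₂ α₂ l₂ n]; ring)
    (R := R) (by positivity) (hτ l₁) hη hQ
  refine hmain.trans ?_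
  have hQQ : ((q₁ ^ l₁ * q₂ ^ l₂ : ℕ) : ℝ) ≤ q * (z ^ 2 * w ^ 8) := by
    calc ((q₁ ^ l₁ * q₂ ^ l₂ : ℕ) : ℝ) = (q₁ ^ l₁ : ℕ) * (q₂ ^ l₂ : ℕ) := by push_cast; ring
      _ ≤ (q₁ * (z * w ^ 4)) * (q₂ * (z * w ^ 4)) := by gcongr
      _ = _ := by rw [hqdef]; ring
  rw [← hκ, hx2]
  have b1 := bad_slopes_term_le hκ0 hw1 hz1 hx0 hmon hq0 (Nat.cast_nonneg _) (Nat.cast_nonneg B) hQQ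
    hH0 hHw hwK hBw
  have b2 := segmentError_term_le (c := c) hw1 hz1 hx0 hmon hz.symm hyx hq0 hQQ hl₁ hl₂ hwH hHw hKw
    hwB hwT hTw
  have b3 := correlation_term_le hκ0 hw1 hz1 hx0 hmon hr0 (by positivity) hRle hH0 hHw hTw
  have b4 := monomial_le hw1 hz1 hmon (i := 5) (j := 32) (by norm_num) (by norm_num)
  linarith

/-- `F` is bounded by a power of `x` with exponent less than one. -/
def PowerSaving (F : ℝ → ℝ) : Prop :=
  ∃ ε : ℝ, 0 < ε ∧ ∃ C : ℝ, ∀ x : ℝ, 1 ≤ x → F x ≤ C * x ^ (1 - ε)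

lemma PowerSaving.add {F G : ℝ → ℝ} (hF : PowerSaving F) (hG : PowerSaving G) :
    PowerSaving fun x => F x + G x := by
  obtain ⟨ε, hε, C, hC⟩ := hF
  obtain ⟨δ, hδ, D, hD⟩ := hG
  refine ⟨min ε δ, lt_min hε hδ, |C| + |D|, fun x hx => ?_⟩
  have h1 : x ^ (1 - ε) ≤ x ^ (1 - min ε δ) :=
    Real.rpow_le_rpow_of_exponent_le hx (by linarith [min_le_left ε δ])
  have h2 : x ^ (1 - δ) ≤ x ^ (1 - min ε δ) :=
    Real.rpow_le_rpow_of_exponent_le hx (by linarith [min_le_right ε δ])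
  rw [add_mul]
  refine add_le_add ((hC x hx).trans ?_) ((hD x hx).trans ?_)
  · exact mul_le_mul (le_abs_self C) h1 (by positivity) (abs_nonneg C)
  · exact mul_le_mul (le_abs_self D) h2 (by positivity) (abs_nonneg D)

lemma PowerSaving.sum {ι : Type*} (P : Finset ι) (F : ι → ℝ → ℝ)
    (h : ∀ p ∈ P, PowerSaving (F p)) : PowerSaving fun x => ∑ p ∈ P, F p x := by
  classical
  induction P using Finset.induction_on with
  | empty => exact ⟨1, one_pos, 0, fun x _ => by simp⟩
  | insert p P hp ih =>
    simp only [Finset.sum_insert hp]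
    exact (h p (mem_insert_self _ _)).add (ih fun r hr => h r (mem_insert_of_mem hr))

lemma sum_ex_div_eq {m : ℕ} (hm : 1 ≤ m) (t : ℤ) :
    ∑ j ∈ range m, ex (j * (t / m)) = if (m : ℤ) ∣ t then (m : ℂ) else 0 := by
  have hm0 : (m : ℝ) ≠ 0 := by exact_mod_cast (by omega : m ≠ 0)
  have hiff : ex ((t : ℝ) / m) = 1 ↔ (m : ℤ) ∣ t := by
    rw [ex_eq_one_iff]
    constructor
    · rintro ⟨n, hn⟩
      rw [div_eq_iff hm0] at hn
      exact ⟨n, by rw [mul_comm]; exact_mod_cast hn⟩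
    · rintro ⟨n, rfl⟩
      exact ⟨n, by push_cast; field_simp⟩
  simp_rw [ex_nat_mul]
  split_ifs with h
  · rw [hiff.2 h]; simp
  · have h1 : ex ((t : ℝ) / m) ≠ 1 := fun h' => h (hiff.1 h')
    rw [geom_sum_eq h1, ← ex_nat_mul, mul_div_cancel₀ _ hm0, ex_int, sub_self, zero_div]

lemma not_exists_int_eq {q m j : ℕ} (hq : 2 ≤ q) (hm : Nat.Coprime m (q - 1)) (hj : j < m)
    (hj0 : j ≠ 0) : ¬ ∃ n : ℤ, ((q : ℝ) - 1) * (j / m) = n := by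
  rintro ⟨n, hn⟩
  have hm0 : (m : ℝ) ≠ 0 := by exact_mod_cast (by omega : m ≠ 0)
  rw [← mul_div_assoc, div_eq_iff hm0] at hn
  have h1 : (((q - 1 : ℕ) * j : ℕ) : ℤ) = n * m := by
    have : (((q - 1 : ℕ) * j : ℕ) : ℝ) = n * m := by
      rw [← hn]; push_cast [Nat.cast_sub (by omega : 1 ≤ q)]; ring
    exact_mod_cast this
  have h2 : m ∣ (q - 1) * j := Int.natCast_dvd_natCast.1 ⟨n, by rw [h1, mul_comm]⟩
  exact absurd (Nat.le_of_dvd (by omega) (hm.dvd_of_dvd_mul_left h2)) (by omega)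

/-- The number of `n ∈ I` with `u n`, `v n` in given residue classes, through exponential sums. -/
lemma card_residue_classes_eq (I : Finset ℕ) (u v : ℕ → ℕ) {m₁ m₂ : ℕ} (hm₁ : 1 ≤ m₁)
    (hm₂ : 1 ≤ m₂) (l₁ l₂ : ℤ)
    [DecidablePred fun n => (u n : ℤ) ≡ l₁ [ZMOD m₁] ∧ (v n : ℤ) ≡ l₂ [ZMOD m₂]] :
    (m₁ * m₂ : ℂ) * ((I.filter fun n => (u n : ℤ) ≡ l₁ [ZMOD m₁] ∧ (v n : ℤ) ≡ l₂ [ZMOD m₂]).card : ℂ)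
      = ∑ p ∈ range m₁ ×ˢ range m₂, ex (-(p.1 * (l₁ / m₁) + p.2 * (l₂ / m₂))) *
          ∑ n ∈ I, ex (p.1 / m₁ * u n) * ex (p.2 / m₂ * v n) := by
  have hind : ∀ n, (if (u n : ℤ) ≡ l₁ [ZMOD m₁] ∧ (v n : ℤ) ≡ l₂ [ZMOD m₂] then (m₁ * m₂ : ℂ) else 0)
      = ∑ p ∈ range m₁ ×ˢ range m₂, ex (-(p.1 * (l₁ / m₁) + p.2 * (l₂ / m₂))) *
        (ex (p.1 / m₁ * u n) * ex (p.2 / m₂ * v n)) := by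
    intro n
    have e : ∀ p : ℕ × ℕ, ex (-(p.1 * (l₁ / m₁) + p.2 * (l₂ / m₂))) *
        (ex (p.1 / m₁ * u n) * ex (p.2 / m₂ * v n))
        = ex (p.1 * (((u n - l₁ : ℤ) : ℝ) / m₁)) * ex (p.2 * (((v n - l₂ : ℤ) : ℝ) / m₂)) := by
      intro p
      rw [← ex_add, ← ex_add, ← ex_add]
      congr 1; push_cast; ring
    simp_rw [e]
    rw [Finset.sum_product]
    simp only
    rw [← Finset.sum_mul_sum, sum_ex_div_eq hm₁, sum_ex_div_eq hm₂]
    have d1 : (u n : ℤ) ≡ l₁ [ZMOD m₁] ↔ (m₁ : ℤ) ∣ u n - l₁ :=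
      Int.modEq_comm.trans Int.modEq_iff_dvd
    have d2 : (v n : ℤ) ≡ l₂ [ZMOD m₂] ↔ (m₂ : ℤ) ∣ v n - l₂ :=
      Int.modEq_comm.trans Int.modEq_iff_dvd
    simp only [d1, d2]
    by_cases h1 : (m₁ : ℤ) ∣ u n - l₁ <;> by_cases h2 : (m₂ : ℤ) ∣ v n - l₂ <;> simp [h1, h2]
  simp_rw [Finset.mul_sum]
  rw [Finset.sum_comm, Finset.sum_congr rfl fun n _ => (hind n).symm, ← Finset.sum_filter, sum_const,
    nsmul_eq_mul, mul_comm]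

open Classical in
/-- Counting the images in `ℝ` of natural numbers is the same as counting the numbers themselves. -/
lemma card_filter_cast (I : Finset ℕ) (p : ℝ → Prop) [DecidablePred p] :
    (I.filter fun y : ℝ => p y).card = (I.filter fun n : ℕ => p n).card := by
  have h : (I : Finset ℝ) = I.image (fun n : ℕ => (n : ℝ)) := by
    ext y
    simp [Finset.bind_def, eq_comm]
  rw [h, Finset.filter_image, Finset.card_image_of_injective _ Nat.cast_injective]

open Classical in
theorem stmt_6 (q₁ q₂ m₁ m₂ : ℕ) (l₁ l₂ : ℤ)
    (hq₁ : 2 ≤ q₁) (hq₂ : 2 ≤ q₂) (hm₁ : 1 ≤ m₁) (hm₂ : 1 ≤ m₂)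
    (hq : Nat.Coprime q₁ q₂)
    (hm₁q : Nat.Coprime m₁ (q₁ - 1)) (hm₂q : Nat.Coprime m₂ (q₂ - 1))
    (c : ℝ) (hc : 1 < c) (hc' : c < 18 / 17) :
    ∃ ε : ℝ, 0 < ε ∧ ∃ C : ℝ, ∀ x : ℝ, 1 ≤ x →
      |(((Finset.Icc 1 ⌊x⌋₊).filter (fun n =>
            (s q₁ ⌊(n : ℝ) ^ c⌋₊ : ℤ) ≡ l₁ [ZMOD m₁] ∧
            (s q₂ ⌊(n : ℝ) ^ c⌋₊ : ℤ) ≡ l₂ [ZMOD m₂])).card : ℝ)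
        - x / ((m₁ : ℝ) * m₂)|
      ≤ C * x ^ (1 - ε) := by
  set S : ℕ × ℕ → ℝ → ℂ := fun p x => ∑ n ∈ Icc 1 ⌊x⌋₊,
    ex (p.1 / m₁ * s q₁ ⌊(n : ℝ) ^ c⌋₊) * ex (p.2 / m₂ * s q₂ ⌊(n : ℝ) ^ c⌋₊) with hS
  set P := (range m₁ ×ˢ range m₂).erase (0, 0) with hP
  have hps : ∀ p ∈ P, PowerSaving fun x => ‖S p x‖ := by
    rintro ⟨j₁, j₂⟩ hp
    rw [hP, mem_erase, mem_product, mem_range, mem_range] at hp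
    obtain ⟨hne, h1, h2⟩ := hp
    by_cases hj : j₁ = 0
    · have hj₂ : j₂ ≠ 0 := fun h => hne (by rw [hj, h])
      have := exists_norm_sum_ex_digits_le hq₂ hq₁ hq.symm hc hc'
        (not_exists_int_eq hq₂ hm₂q h2 hj₂) ((j₁ : ℝ) / m₁)
      simpa only [PowerSaving, hS, mul_comm (ex ((j₁ : ℝ) / m₁ * _))] using this
    · exact exists_norm_sum_ex_digits_le hq₁ hq₂ hq hc hc' (not_exists_int_eq hq₁ hm₁q h1 hj) _
  have hone : PowerSaving fun _ => 1 := ⟨1, one_pos, 1, fun x _ => by simp⟩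
  obtain ⟨ε, hε, C, hC⟩ := (PowerSaving.sum P (fun p x => ‖S p x‖) hps).add hone
  refine ⟨ε, hε, C, fun x hx => le_trans ?_ (hC x hx)⟩
  have hcard := card_residue_classes_eq (Icc 1 ⌊x⌋₊) (fun n => s q₁ ⌊(n : ℝ) ^ c⌋₊)
    (fun n => s q₂ ⌊(n : ℝ) ^ c⌋₊) hm₁ hm₂ l₁ l₂
  rw [card_filter_cast]
  set N := ((Icc 1 ⌊x⌋₊).filter fun n : ℕ => (s q₁ ⌊(n : ℝ) ^ c⌋₊ : ℤ) ≡ l₁ [ZMOD m₁] ∧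
            (s q₂ ⌊(n : ℝ) ^ c⌋₊ : ℤ) ≡ l₂ [ZMOD m₂]).card with hN
  have h00 : ((0, 0) : ℕ × ℕ) ∈ range m₁ ×ˢ range m₂ := by
    simp only [mem_product, mem_range]; omega
  rw [← Finset.add_sum_erase _ _ h00] at hcard
  simp only [Nat.cast_zero, zero_mul, add_zero, neg_zero, ex_zero, zero_div, one_mul, sum_const,
    Nat.card_Icc, Nat.add_sub_cancel, nsmul_eq_mul, mul_one] at hcard
  have hm : (1 : ℝ) ≤ m₁ * m₂ := by
    exact_mod_cast Nat.mul_pos hm₁ hm₂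
  have hm0 : (0 : ℝ) < m₁ * m₂ := by linarith
  have hdiff : |(m₁ * m₂ : ℝ) * N - ⌊x⌋₊| ≤ ∑ p ∈ P, ‖S p x‖ := by
    rw [← Real.norm_eq_abs, ← Complex.norm_real]
    push_cast
    rw [hcard, add_sub_cancel_left]
    refine norm_sum_le_of_le _ fun p _ => ?_
    rw [norm_mul, norm_ex, one_mul]
  have hfl : |(⌊x⌋₊ : ℝ) - x| ≤ 1 := by
    rw [abs_le]
    constructor <;> linarith [Nat.floor_le (show 0 ≤ x by linarith), Nat.lt_floor_add_one x]
  have e : (N : ℝ) - x / (m₁ * m₂) = ((m₁ * m₂ : ℝ) * N - ⌊x⌋₊ + (⌊x⌋₊ - x)) / (m₁ * m₂) := by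
    field_simp; ring
  rw [e, abs_div, abs_of_pos hm0]
  exact (div_le_self (abs_nonneg _) hm).trans ((abs_add_le _ _).trans (add_le_add hdiff hfl))
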